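/- arXiv:1211.4387 — 5 statements merged into one kernel-verified Lean document; each statement's English description precedes it below -/
import Mathlib

section
/- Let R be a commutative ring, let g ≥ 1, and let M be a 2g×2g matrix over R such that Mᵀ J M = λ • J for some unit λ ∈ Rˣ, where J is the 2g×2g block matrix (0 I_g; −I_g 0). Then det M = λ^g. -/
open Matrix

/-- The standard symplectic form matrix `(0 I_g; -I_g 0)`. -/
def Jmat (g : ℕ) (R : Type*) [CommRing R] :
    Matrix (Fin g ⊕ Fin g) (Fin g ⊕ Fin g) R :=
  Matrix.fromBlocks 0 1 (-1) 0

theorem Jmat_eq_neg_J (g : ℕ) (R : Type*) [CommRing R] : Jmat g R = -Matrix.J (Fin g) R := by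
  simp [Jmat, Matrix.J, fromBlocks_neg]

/-- Rescaling the second half of the columns of a symplectic similitude by the inverse of its
multiplier gives a symplectic matrix. -/
theorem mul_fromBlocks_inv_mem_symplecticGroup {R : Type*} [CommRing R] {g : ℕ}
    {M : Matrix (Fin g ⊕ Fin g) (Fin g ⊕ Fin g) R} {l : Rˣ}
    (h : Mᵀ * Jmat g R * M = (l : R) • Jmat g R) :
    M * fromBlocks 1 0 0 ((↑l⁻¹ : R) • 1) ∈ symplecticGroup (Fin g) R := by
  have hJ : Mᵀ * J (Fin g) R * M = (l : R) • J (Fin g) R := by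
    simpa [Jmat_eq_neg_J] using h
  set D : Matrix (Fin g ⊕ Fin g) (Fin g ⊕ Fin g) R := fromBlocks 1 0 0 ((↑l⁻¹ : R) • 1) with hD
  rw [SymplecticGroup.mem_iff']
  calc (M * D)ᵀ * J (Fin g) R * (M * D) = Dᵀ * (Mᵀ * J (Fin g) R * M) * D := by
        simp only [transpose_mul, Matrix.mul_assoc]
    _ = J (Fin g) R := by
        rw [hJ, hD]
        simp [J, fromBlocks_transpose, fromBlocks_multiply, fromBlocks_smul, smul_smul]

theorem statement0 (R : Type*) [CommRing R] (g : ℕ) (hg : 1 ≤ g)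
    (M : Matrix (Fin g ⊕ Fin g) (Fin g ⊕ Fin g) R) (l : Rˣ)
    (h : Mᵀ * Jmat g R * M = (l : R) • Jmat g R) :
    M.det = (l : R) ^ g := by
  have hdet := SymplecticGroup.det_eq_one (mul_fromBlocks_inv_mem_symplecticGroup h)
  rw [det_mul, det_fromBlocks_zero₂₁, det_one, one_mul, det_smul, det_one, mul_one,
    Fintype.card_fin] at hdet
  calc M.det = M.det * (↑l⁻¹ : R) ^ g * (l : R) ^ g := by
        rw [mul_assoc, ← mul_pow, Units.inv_mul, one_pow, mul_one]
    _ = (l : R) ^ g := by rw [hdet, one_mul]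
end

section
/- Let ℓ be an odd prime, let g₁, g₂ ≥ 1, and for i ∈ {1,2} let Z_i be a subgroup of Sp_{2g_i}(ZMod ℓ) contained in {I_{2g_i}, −I_{2g_i}}. If the cardinality of the quotient Sp_{2g₁}(ZMod ℓ)/Z₁ equals the cardinality of the quotient Sp_{2g₂}(ZMod ℓ)/Z₂, then g₁ = g₂ and Z₁ = Z₂. -/
open Matrix

/-- The symplectic group `Sp_{2g}(R)`: matrices `M` with `Mᵀ J M = J`,
as a subgroup of `GL`. -/
def Sp (g : ℕ) (R : Type*) [CommRing R] :
    Subgroup (GL (Fin g ⊕ Fin g) R) where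
  carrier := {M | (M : Matrix (Fin g ⊕ Fin g) (Fin g ⊕ Fin g) R)ᵀ * Jmat g R * M = Jmat g R}
  one_mem' := by simp
  mul_mem' := by
    intro a b ha hb
    have ha' : (a : Matrix (Fin g ⊕ Fin g) (Fin g ⊕ Fin g) R)ᵀ * Jmat g R * a = Jmat g R := ha
    have hb' : (b : Matrix (Fin g ⊕ Fin g) (Fin g ⊕ Fin g) R)ᵀ * Jmat g R * b = Jmat g R := hb
    show ((a * b : GL (Fin g ⊕ Fin g) R) : Matrix (Fin g ⊕ Fin g) (Fin g ⊕ Fin g) R)ᵀ *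
        Jmat g R * (a * b : GL (Fin g ⊕ Fin g) R) = Jmat g R
    rw [Units.val_mul, Matrix.transpose_mul]
    calc (b : Matrix (Fin g ⊕ Fin g) (Fin g ⊕ Fin g) R)ᵀ *
          (a : Matrix (Fin g ⊕ Fin g) (Fin g ⊕ Fin g) R)ᵀ * Jmat g R *
          ((a : Matrix (Fin g ⊕ Fin g) (Fin g ⊕ Fin g) R) * b)
        = (b : Matrix (Fin g ⊕ Fin g) (Fin g ⊕ Fin g) R)ᵀ *
          ((a : Matrix (Fin g ⊕ Fin g) (Fin g ⊕ Fin g) R)ᵀ * Jmat g R *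
            (a : Matrix (Fin g ⊕ Fin g) (Fin g ⊕ Fin g) R)) * b := by
          simp only [Matrix.mul_assoc]
      _ = Jmat g R := by rw [ha', hb']
  inv_mem' := by
    intro a ha
    have ha' : (a : Matrix (Fin g ⊕ Fin g) (Fin g ⊕ Fin g) R)ᵀ * Jmat g R * a = Jmat g R := ha
    show ((a⁻¹ : GL (Fin g ⊕ Fin g) R) : Matrix (Fin g ⊕ Fin g) (Fin g ⊕ Fin g) R)ᵀ *
        Jmat g R * (a⁻¹ : GL (Fin g ⊕ Fin g) R) = Jmat g R
    have h1 : (a : Matrix (Fin g ⊕ Fin g) (Fin g ⊕ Fin g) R) *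
        ((a⁻¹ : GL (Fin g ⊕ Fin g) R) : Matrix (Fin g ⊕ Fin g) (Fin g ⊕ Fin g) R) = 1 :=
      a.mul_inv
    calc ((a⁻¹ : GL (Fin g ⊕ Fin g) R) : Matrix (Fin g ⊕ Fin g) (Fin g ⊕ Fin g) R)ᵀ *
          Jmat g R * ((a⁻¹ : GL (Fin g ⊕ Fin g) R) : Matrix (Fin g ⊕ Fin g) (Fin g ⊕ Fin g) R)
        = ((a⁻¹ : GL (Fin g ⊕ Fin g) R) : Matrix (Fin g ⊕ Fin g) (Fin g ⊕ Fin g) R)ᵀ *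
          ((a : Matrix (Fin g ⊕ Fin g) (Fin g ⊕ Fin g) R)ᵀ * Jmat g R * a) *
          ((a⁻¹ : GL (Fin g ⊕ Fin g) R) : Matrix (Fin g ⊕ Fin g) (Fin g ⊕ Fin g) R) := by
          rw [ha']
      _ = ((a : Matrix (Fin g ⊕ Fin g) (Fin g ⊕ Fin g) R) *
            ((a⁻¹ : GL (Fin g ⊕ Fin g) R) : Matrix (Fin g ⊕ Fin g) (Fin g ⊕ Fin g) R))ᵀ *
          Jmat g R *
          ((a : Matrix (Fin g ⊕ Fin g) (Fin g ⊕ Fin g) R) *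
            ((a⁻¹ : GL (Fin g ⊕ Fin g) R) : Matrix (Fin g ⊕ Fin g) (Fin g ⊕ Fin g) R)) := by
          rw [Matrix.transpose_mul]
          simp only [Matrix.mul_assoc]
      _ = Jmat g R := by rw [h1]; simp

/-- A matrix preserving the symplectic form is invertible, hence comes from `Sp`. -/
theorem Sp.exists_coe_eq {g : ℕ} {R : Type*} [CommRing R]
    {M : Matrix (Fin g ⊕ Fin g) (Fin g ⊕ Fin g) R} (hM : Mᵀ * Jmat g R * M = Jmat g R) :
    ∃ A : Sp g R, A.1.val = M := by
  have hJ : Jmat g R * Jmat g R = -1 := by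
    rw [Jmat, fromBlocks_multiply, ← fromBlocks_one, fromBlocks_neg]
    simp
  have hinv : -(Jmat g R * Mᵀ * Jmat g R) * M = 1 := by
    rw [Matrix.neg_mul, Matrix.mul_assoc, Matrix.mul_assoc, ← Matrix.mul_assoc Mᵀ, hM, hJ, neg_neg]
  exact ⟨⟨⟨M, _, mul_eq_one_comm.mp hinv, hinv⟩, hM⟩, rfl⟩

/-- Regrouping of coordinates realizing the orthogonal sum of two symplectic spaces. -/
def sumSymplecticEquiv (g h : ℕ) :
    Fin (g + h) ⊕ Fin (g + h) ≃ (Fin g ⊕ Fin g) ⊕ (Fin h ⊕ Fin h) :=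
  (Equiv.sumCongr finSumFinEquiv.symm finSumFinEquiv.symm).trans
    (Equiv.sumSumSumComm (Fin g) (Fin h) (Fin g) (Fin h))

theorem Jmat_add (g h : ℕ) (R : Type*) [CommRing R] :
    Jmat (g + h) R = (fromBlocks (Jmat g R) 0 0 (Jmat h R)).submatrix
      (sumSymplecticEquiv g h) (sumSymplecticEquiv g h) := by
  ext i j
  rcases i with i | i <;> rcases j with j | j <;>
    induction i using Fin.addCases <;> induction j using Fin.addCases <;>
    simp [Jmat, sumSymplecticEquiv, Matrix.one_apply, Fin.ext_iff] <;> omega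

/-- The block-diagonal embedding `Sp g × Sp h → Sp (g + h)`. -/
theorem Sp.exists_injective_prod (g h : ℕ) (R : Type*) [CommRing R] :
    ∃ f : Sp g R × Sp h R → Sp (g + h) R, Function.Injective f := by
  have key (p : Sp g R × Sp h R) : ∃ A : Sp (g + h) R,
      A.1.val = (fromBlocks p.1.1.val 0 0 p.2.1.val).submatrix
        (sumSymplecticEquiv g h) (sumSymplecticEquiv g h) := by
    apply Sp.exists_coe_eq
    have h₁ : p.1.1.valᵀ * Jmat g R * p.1.1.val = Jmat g R := p.1.2
    have h₂ : p.2.1.valᵀ * Jmat h R * p.2.1.val = Jmat h R := p.2.2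
    rw [Jmat_add, transpose_submatrix, submatrix_mul_equiv, submatrix_mul_equiv,
      fromBlocks_transpose, fromBlocks_multiply, fromBlocks_multiply]
    simp [h₁, h₂]
  choose f hf using key
  refine ⟨f, fun p q hpq => ?_⟩
  have hblocks := hf p
  rw [hpq, hf q] at hblocks
  have hinj := (Matrix.reindex (sumSymplecticEquiv g h).symm
    (sumSymplecticEquiv g h).symm (α := R)).injective hblocks
  obtain ⟨h₁, -, -, h₂⟩ := fromBlocks_inj.mp hinj.symm
  exact Prod.ext (Subtype.ext (Units.ext h₁)) (Subtype.ext (Units.ext h₂))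

/-- The upper unitriangular matrices embed `R` into `Sp 1 R`. -/
theorem Sp.exists_injective_one (R : Type*) [CommRing R] :
    ∃ f : R → Sp 1 R, Function.Injective f := by
  have key (c : R) : ∃ A : Sp 1 R, A.1.val = fromBlocks 1 (c • 1) 0 1 := by
    apply Sp.exists_coe_eq
    rw [Jmat, fromBlocks_transpose, fromBlocks_multiply, fromBlocks_multiply]
    simp
  choose f hf using key
  refine ⟨f, fun c d hcd => ?_⟩
  have hmat := hf c
  rw [hcd, hf d] at hmat
  simpa using Eq.symm <| congrFun (congrFun (fromBlocks_inj.mp hmat).2.1 0) 0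

theorem Sp.two_mul_card_lt {R : Type*} [CommRing R] [Finite R] (hR : 2 < Nat.card R)
    {g k : ℕ} (hgk : g < k) : 2 * Nat.card (Sp g R) < Nat.card (Sp k R) := by
  have hsucc (n : ℕ) : 2 * Nat.card (Sp n R) < Nat.card (Sp (n + 1) R) := by
    obtain ⟨f, hf⟩ := Sp.exists_injective_prod n 1 R
    obtain ⟨t, ht⟩ := Sp.exists_injective_one R
    have hprod := Nat.card_le_card_of_injective f hf
    rw [Nat.card_prod] at hprod
    have hone := Nat.card_le_card_of_injective t ht
    have hpos : 0 < Nat.card (Sp n R) := Nat.card_pos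
    nlinarith
  have hmono : StrictMono fun n => Nat.card (Sp n R) :=
    strictMono_nat_of_lt_succ fun n => by have := hsucc n; omega
  exact (hsucc g).trans_le (hmono.monotone hgk)

theorem Sp.card_le_two_of_forall_eq_one_or_neg_one {g : ℕ} {R : Type*} [CommRing R]
    (Z : Subgroup (Sp g R))
    (hZ : ∀ z ∈ Z, z.1.val = 1 ∨ z.1.val = -1) : Nat.card Z ≤ 2 := by
  let f : Z → ({1, -1} : Set (Matrix (Fin g ⊕ Fin g) (Fin g ⊕ Fin g) R)) :=
    fun z => ⟨((z : Sp g R) : GL (Fin g ⊕ Fin g) R), hZ z z.2⟩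
  have hf : Function.Injective f := fun a b hab =>
    Subtype.ext (Subtype.ext (Units.ext (congrArg Subtype.val hab)))
  exact (Nat.card_le_card_of_injective f hf).trans
    ((Set.ncard_insert_le _ _).trans (by rw [Set.ncard_singleton]))

theorem Sp.le_of_card_eq_of_forall_eq_one_or_neg_one {g : ℕ} {R : Type*} [CommRing R]
    {Z W : Subgroup (Sp g R)}
    (hZ : ∀ z ∈ Z, z.1.val = 1 ∨ z.1.val = -1)
    (hW : ∀ z ∈ W, z.1.val = 1 ∨ z.1.val = -1)
    (hcard : Nat.card Z = Nat.card W) : Z ≤ W := by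
  intro z hz
  rcases hZ z hz with h | h
  · rw [show z = 1 from Subtype.ext (Units.ext h)]
    exact W.one_mem
  by_cases hW' : W = ⊥
  · rw [hW', Subgroup.card_bot, Subgroup.card_eq_one] at hcard
    rw [hcard, Subgroup.mem_bot] at hz
    exact hz ▸ W.one_mem
  obtain ⟨w, hw, hw1⟩ := W.bot_or_exists_ne_one.resolve_left hW'
  rcases hW w hw with h' | h'
  · exact absurd (Subtype.ext (Units.ext h')) hw1
  · rwa [show z = w from Subtype.ext (Units.ext (h.trans h'.symm))]

/-- Different ranks give quotients of different sizes. -/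
theorem Sp.not_lt_of_card_quotient_eq {R : Type*} [CommRing R] [Finite R] (hR : 2 < Nat.card R)
    {g k : ℕ} (Z : Subgroup (Sp g R)) (W : Subgroup (Sp k R))
    (hW : ∀ z ∈ W, z.1.val = 1 ∨ z.1.val = -1)
    (hcard : Nat.card (Sp g R ⧸ Z) = Nat.card (Sp k R ⧸ W)) : ¬ g < k := by
  intro hgk
  have hlt := Sp.two_mul_card_lt hR hgk
  rw [Z.card_eq_card_quotient_mul_card_subgroup, W.card_eq_card_quotient_mul_card_subgroup,
    hcard] at hlt
  have hW2 := Sp.card_le_two_of_forall_eq_one_or_neg_one W hW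
  have hZpos : 0 < Nat.card Z := Nat.card_pos
  nlinarith [Nat.mul_le_mul_left (Nat.card (Sp k R ⧸ W)) hW2,
    Nat.mul_le_mul_left (Nat.card (Sp k R ⧸ W)) hZpos]

theorem statement1 (ℓ : ℕ) (hℓ : ℓ.Prime) (hodd : Odd ℓ)
    (g₁ g₂ : ℕ) (hg₁ : 1 ≤ g₁) (hg₂ : 1 ≤ g₂)
    (Z₁ : Subgroup ↥(Sp g₁ (ZMod ℓ))) (Z₂ : Subgroup ↥(Sp g₂ (ZMod ℓ)))
    (hZ₁ : ∀ z ∈ Z₁,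
      ((z : GL (Fin g₁ ⊕ Fin g₁) (ZMod ℓ)) : Matrix (Fin g₁ ⊕ Fin g₁) (Fin g₁ ⊕ Fin g₁) (ZMod ℓ)) = 1 ∨
      ((z : GL (Fin g₁ ⊕ Fin g₁) (ZMod ℓ)) : Matrix (Fin g₁ ⊕ Fin g₁) (Fin g₁ ⊕ Fin g₁) (ZMod ℓ)) = -1)
    (hZ₂ : ∀ z ∈ Z₂,
      ((z : GL (Fin g₂ ⊕ Fin g₂) (ZMod ℓ)) : Matrix (Fin g₂ ⊕ Fin g₂) (Fin g₂ ⊕ Fin g₂) (ZMod ℓ)) = 1 ∨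
      ((z : GL (Fin g₂ ⊕ Fin g₂) (ZMod ℓ)) : Matrix (Fin g₂ ⊕ Fin g₂) (Fin g₂ ⊕ Fin g₂) (ZMod ℓ)) = -1)
    (hcard : Nat.card (↥(Sp g₁ (ZMod ℓ)) ⧸ Z₁) = Nat.card (↥(Sp g₂ (ZMod ℓ)) ⧸ Z₂)) :
    g₁ = g₂ ∧ HEq Z₁ Z₂ := by
  have : Fact ℓ.Prime := ⟨hℓ⟩
  have hR : 2 < Nat.card (ZMod ℓ) := by
    rw [Nat.card_zmod]
    have := hℓ.two_le
    obtain ⟨m, hm⟩ := hodd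
    omega
  obtain rfl : g₁ = g₂ := le_antisymm
    (not_lt.mp (Sp.not_lt_of_card_quotient_eq hR Z₂ Z₁ hZ₁ hcard.symm))
    (not_lt.mp (Sp.not_lt_of_card_quotient_eq hR Z₁ Z₂ hZ₂ hcard))
  have hZcard : Nat.card Z₁ = Nat.card Z₂ := by
    have h := Z₁.card_eq_card_quotient_mul_card_subgroup
    rw [Z₂.card_eq_card_quotient_mul_card_subgroup, hcard] at h
    exact (Nat.eq_of_mul_eq_mul_left Nat.card_pos h).symm
  exact ⟨rfl, heq_of_eq (le_antisymm
    (Sp.le_of_card_eq_of_forall_eq_one_or_neg_one hZ₁ hZ₂ hZcard)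
    (Sp.le_of_card_eq_of_forall_eq_one_or_neg_one hZ₂ hZ₁ hZcard.symm))⟩
end

section
/- Let F be a field and g ≥ 1, and exclude the cases where g = 1 and F has at most 4 elements, and where g = 2 and F has exactly 2 elements. Then every normal subgroup N of Sp_{2g}(F) satisfies either N ⊆ {I_{2g}, −I_{2g}} or N = Sp_{2g}(F). In particular the only normal subgroup of Sp_{2g}(F) other than the trivial subgroup and the whole group is its center {I_{2g}, −I_{2g}}. -/
open Matrix

namespace SymplecticGenerators

variable {F : Type*} [Field F] {g : ℕ}

/-- The standard symplectic form on `F ^ (2 * g)`. -/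
noncomputable def form (g : ℕ) (F : Type*) [Field F] : LinearMap.BilinForm F (Fin g ⊕ Fin g → F) :=
  Matrix.toBilin' (Jmat g F)

lemma form_apply (u v : Fin g ⊕ Fin g → F) :
    form g F u v = ∑ i, (u (Sum.inl i) * v (Sum.inr i) - u (Sum.inr i) * v (Sum.inl i)) := by
  have hv : v = Sum.elim (v ∘ Sum.inl) (v ∘ Sum.inr) := (Sum.elim_comp_inl_inr v).symm
  rw [form, Matrix.toBilin'_apply', Jmat, hv, Matrix.fromBlocks_mulVec]
  simp [dotProduct, Matrix.neg_mulVec, Finset.sum_sub_distrib, ← sub_eq_add_neg]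

lemma form_self (u : Fin g ⊕ Fin g → F) : form g F u u = 0 := by
  simp [form_apply, mul_comm]

lemma form_swap (u v : Fin g ⊕ Fin g → F) : form g F u v = -form g F v u := by
  simp only [form_apply, ← Finset.sum_neg_distrib]
  exact Finset.sum_congr rfl fun _ _ ↦ by ring

lemma form_single_inl (i : Fin g) (v : Fin g ⊕ Fin g → F) :
    form g F (Pi.single (Sum.inl i) 1) v = v (Sum.inr i) := by
  simp [form_apply, Pi.single_apply]

lemma form_single_inr (i : Fin g) (v : Fin g ⊕ Fin g → F) :
    form g F (Pi.single (Sum.inr i) 1) v = -v (Sum.inl i) := by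
  simp [form_apply, Pi.single_apply]

lemma smul_eq (x : Sp g F) (v : Fin g ⊕ Fin g → F) :
    x • v = ((x : GL (Fin g ⊕ Fin g) F) : Matrix (Fin g ⊕ Fin g) (Fin g ⊕ Fin g) F) *ᵥ v := rfl

lemma eq_of_smul_eq {x y : Sp g F} (h : ∀ v : Fin g ⊕ Fin g → F, x • v = y • v) : x = y :=
  Subtype.ext (Units.ext (Matrix.ext_iff_mulVec.2 h))

lemma mem_Sp_iff (M : GL (Fin g ⊕ Fin g) F) :
    M ∈ Sp g F ↔ ∀ u v : Fin g ⊕ Fin g → F, form g F (M • u) (M • v) = form g F u v := by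
  change (M : Matrix (Fin g ⊕ Fin g) (Fin g ⊕ Fin g) F)ᵀ * Jmat g F * M = Jmat g F ↔ _
  rw [← Matrix.toBilin'.injective.eq_iff, ← Matrix.toBilin'_comp, LinearMap.BilinForm.ext_iff]
  rfl

lemma form_smul_smul (x : Sp g F) (u v : Fin g ⊕ Fin g → F) :
    form g F (x • u) (x • v) = form g F u v :=
  (mem_Sp_iff (x : GL (Fin g ⊕ Fin g) F)).1 x.2 u v

/-- The matrix of the map `v ↦ form u v • u`. -/
def rankOne (u : Fin g ⊕ Fin g → F) : Matrix (Fin g ⊕ Fin g) (Fin g ⊕ Fin g) F :=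
  Matrix.vecMulVec u (u ᵥ* Jmat g F)

lemma rankOne_mulVec (u v : Fin g ⊕ Fin g → F) : rankOne u *ᵥ v = form g F u v • u := by
  rw [rankOne, Matrix.vecMulVec_mulVec, form, Matrix.toBilin'_apply', Matrix.dotProduct_mulVec]
  simp

lemma add_rankOne_mul_sub_rankOne (u : Fin g ⊕ Fin g → F) (c : F) :
    (1 + c • rankOne u) * (1 - c • rankOne u) = 1 := by
  refine Matrix.ext_iff_mulVec.2 fun v ↦ ?_
  rw [← Matrix.mulVec_mulVec]
  simp only [Matrix.add_mulVec, Matrix.sub_mulVec, Matrix.one_mulVec, Matrix.smul_mulVec,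
    rankOne_mulVec, map_sub, map_smul, form_self]
  simp

/-- The symplectic transvection `v ↦ v + c * form u v • u`. -/
def transvection (u : Fin g ⊕ Fin g → F) (c : F) : Sp g F :=
  ⟨⟨1 + c • rankOne u, 1 - c • rankOne u, add_rankOne_mul_sub_rankOne u c,
      by simpa [← sub_eq_add_neg] using add_rankOne_mul_sub_rankOne u (-c)⟩, by
    rw [mem_Sp_iff]
    intro v w
    change form g F ((1 + c • rankOne u) *ᵥ v) ((1 + c • rankOne u) *ᵥ w) = _
    simp only [Matrix.add_mulVec, Matrix.one_mulVec, Matrix.smul_mulVec, rankOne_mulVec, map_add,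
      map_smul, LinearMap.add_apply, LinearMap.smul_apply, form_self, form_swap v u, smul_eq_mul]
    ring⟩

lemma transvection_smul (u : Fin g ⊕ Fin g → F) (c : F) (v : Fin g ⊕ Fin g → F) :
    transvection u c • v = v + (c * form g F u v) • u := by
  change (1 + c • rankOne u) *ᵥ v = _
  rw [Matrix.add_mulVec, Matrix.one_mulVec, Matrix.smul_mulVec, rankOne_mulVec, smul_smul]

lemma transvection_mul (u : Fin g ⊕ Fin g → F) (c d : F) :
    transvection u c * transvection u d = transvection u (c + d) := by
  refine eq_of_smul_eq fun v ↦ ?_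
  simp only [mul_smul, transvection_smul, map_add, map_smul, form_self]
  module

lemma transvection_zero (u : Fin g ⊕ Fin g → F) : transvection u 0 = 1 :=
  eq_of_smul_eq fun v ↦ by simp [transvection_smul]

lemma transvection_zero_vec (c : F) : transvection (0 : Fin g ⊕ Fin g → F) c = 1 :=
  eq_of_smul_eq fun v ↦ by simp [transvection_smul]

lemma transvection_inv (u : Fin g ⊕ Fin g → F) (c : F) :
    (transvection u c)⁻¹ = transvection u (-c) :=
  inv_eq_of_mul_eq_one_right (by rw [transvection_mul, add_neg_cancel, transvection_zero])

lemma transvection_vec_smul (u : Fin g ⊕ Fin g → F) (a c : F) :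
    transvection (a • u) c = transvection u (a ^ 2 * c) := by
  refine eq_of_smul_eq fun v ↦ ?_
  simp only [transvection_smul, map_smul, LinearMap.smul_apply, smul_eq_mul]
  module

lemma conj_transvection (x : Sp g F) (u : Fin g ⊕ Fin g → F) (c : F) :
    x * transvection u c * x⁻¹ = transvection (x • u) c := by
  refine eq_of_smul_eq fun v ↦ ?_
  have h : form g F u (x⁻¹ • v) = form g F (x • u) v := by
    rw [← form_smul_smul x, smul_inv_smul]
  rw [mul_smul, mul_smul, transvection_smul, transvection_smul, smul_add, smul_inv_smul, h,
    smul_comm]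

/-- The subgroup generated by the transvections along vectors of `W`. -/
def transvectionSubgroup (W : Submodule F (Fin g ⊕ Fin g → F)) : Subgroup (Sp g F) :=
  Subgroup.closure {t | ∃ u ∈ W, ∃ c, t = transvection u c}

lemma transvection_mem {W : Submodule F (Fin g ⊕ Fin g → F)} {u : Fin g ⊕ Fin g → F} (hu : u ∈ W)
    (c : F) : transvection u c ∈ transvectionSubgroup W :=
  Subgroup.subset_closure ⟨u, hu, c, rfl⟩

lemma transvectionSubgroup_mono {W W' : Submodule F (Fin g ⊕ Fin g → F)} (h : W ≤ W') :
    transvectionSubgroup W ≤ transvectionSubgroup W' :=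
  Subgroup.closure_mono fun _ ⟨u, hu, c, ht⟩ ↦ ⟨u, h hu, c, ht⟩

lemma smul_eq_self_of_mem_transvectionSubgroup {W : Submodule F (Fin g ⊕ Fin g → F)}
    {v : Fin g ⊕ Fin g → F} (hv : ∀ u ∈ W, form g F u v = 0) {t : Sp g F}
    (ht : t ∈ transvectionSubgroup W) : t • v = v := by
  suffices transvectionSubgroup W ≤ MulAction.stabilizer (Sp g F) v from this ht
  refine (Subgroup.closure_le _).2 ?_
  rintro _ ⟨u, hu, c, rfl⟩
  change transvection u c • v = v
  simp [transvection_smul, hv u hu]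

/-- The form is nondegenerate on the subspace `W`. -/
def NondegenerateOn (W : Submodule F (Fin g ⊕ Fin g → F)) : Prop :=
  ∀ u ∈ W, u ≠ 0 → ∃ w ∈ W, form g F u w ≠ 0

lemma NondegenerateOn.exists_form_ne_zero {W : Submodule F (Fin g ⊕ Fin g → F)}
    (hW : NondegenerateOn W) {u v : Fin g ⊕ Fin g → F} (hu : u ∈ W) (hv : v ∈ W)
    (hu0 : u ≠ 0) (hv0 : v ≠ 0) : ∃ w ∈ W, form g F u w ≠ 0 ∧ form g F v w ≠ 0 := by
  obtain ⟨a, ha, hua⟩ := hW u hu hu0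
  obtain ⟨b, hb, hvb⟩ := hW v hv hv0
  by_cases hva : form g F v a = 0
  · by_cases hub : form g F u b = 0
    · exact ⟨a + b, W.add_mem ha hb, by simpa [hub], by simpa [hva]⟩
    · exact ⟨b, hb, hub, hvb⟩
  · exact ⟨a, ha, hua, hva⟩

lemma transvection_sub_smul {x y : Fin g ⊕ Fin g → F} (h : form g F x y ≠ 0) :
    transvection (x - y) (-(form g F x y)⁻¹) • x = y := by
  rw [transvection_smul, map_sub, LinearMap.sub_apply, form_self, form_swap y x,
    zero_sub, neg_neg, neg_mul, inv_mul_cancel₀ h]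
  simp

lemma NondegenerateOn.exists_smul_eq {W : Submodule F (Fin g ⊕ Fin g → F)}
    (hW : NondegenerateOn W) {x y : Fin g ⊕ Fin g → F} (hx : x ∈ W) (hy : y ∈ W)
    (hx0 : x ≠ 0) (hy0 : y ≠ 0) : ∃ t ∈ transvectionSubgroup W, t • x = y := by
  obtain ⟨z, hz, hxz, hyz⟩ := hW.exists_form_ne_zero hx hy hx0 hy0
  have hzy : form g F z y ≠ 0 := by rwa [form_swap, neg_ne_zero]
  refine ⟨_, Subgroup.mul_mem _
    (transvection_mem (W.sub_mem hz hy) (-(form g F z y)⁻¹))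
    (transvection_mem (W.sub_mem hx hz) (-(form g F x z)⁻¹)), ?_⟩
  rw [mul_smul, transvection_sub_smul hxz, transvection_sub_smul hzy]

lemma exists_smul_eq_and_smul_eq_self_of_form_ne_zero {W : Submodule F (Fin g ⊕ Fin g → F)}
    {x y z : Fin g ⊕ Fin g → F} (hy : y ∈ W) (hz : z ∈ W)
    (h : form g F x y = form g F x z) (hyz : form g F y z ≠ 0) :
    ∃ t ∈ transvectionSubgroup W, t • x = x ∧ t • y = z := by
  refine ⟨_, transvection_mem (W.sub_mem hy hz) (-(form g F y z)⁻¹), ?_,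
    transvection_sub_smul hyz⟩
  rw [transvection_smul, form_swap _ x, map_sub, h]
  simp

lemma exists_smul_eq_and_smul_eq_self {W : Submodule F (Fin g ⊕ Fin g → F)}
    {x y z : Fin g ⊕ Fin g → F} (hx : x ∈ W) (hy : y ∈ W) (hz : z ∈ W)
    (h : form g F x y = form g F x z) (hxy : form g F x y ≠ 0) :
    ∃ t ∈ transvectionSubgroup W, t • x = x ∧ t • y = z := by
  by_cases hyz : form g F y z = 0
  · obtain ⟨s, hs, hsx, hsy⟩ := exists_smul_eq_and_smul_eq_self_of_form_ne_zero
      (x := x) (z := y + x) hy (W.add_mem hy hx) (by simp [form_self])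
      (by simpa [form_self, form_swap y x] using hxy)
    obtain ⟨t, ht, htx, hty⟩ := exists_smul_eq_and_smul_eq_self_of_form_ne_zero
      (x := x) (y := y + x) (z := z) (W.add_mem hy hx) hz (by simp [form_self, h])
      (by simpa [hyz, ← h] using hxy)
    exact ⟨t * s, Subgroup.mul_mem _ ht hs, by rw [mul_smul, hsx, htx], by rw [mul_smul, hsy, hty]⟩
  · exact exists_smul_eq_and_smul_eq_self_of_form_ne_zero hy hz h hyz

lemma ne_zero_of_form_ne_zero {x y : Fin g ⊕ Fin g → F} (h : form g F x y ≠ 0) : x ≠ 0 := by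
  rintro rfl
  simp at h

/-- The transvections along a nondegenerate subspace act transitively on its pairs of vectors with
a given nonzero pairing. -/
lemma NondegenerateOn.exists_smul_pair_eq {W : Submodule F (Fin g ⊕ Fin g → F)}
    (hW : NondegenerateOn W) {x y x' y' : Fin g ⊕ Fin g → F} (hx : x ∈ W) (hy : y ∈ W)
    (hx' : x' ∈ W) (hy' : y' ∈ W) (h : form g F x y = form g F x' y') (h0 : form g F x y ≠ 0) :
    ∃ t ∈ transvectionSubgroup W, t • x = x' ∧ t • y = y' := by
  obtain ⟨s, hs, hsx⟩ := hW.exists_smul_eq hx hx' (ne_zero_of_form_ne_zero h0)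
    (ne_zero_of_form_ne_zero (h ▸ h0))
  have hsW : ∀ t ∈ transvectionSubgroup W, ∀ w ∈ W, t • w ∈ W := by
    intro t ht
    induction ht using Subgroup.closure_induction'' with
    | one => simp
    | mem t ht =>
      obtain ⟨u, hu, c, rfl⟩ := ht
      intro w hw
      rw [transvection_smul]
      exact W.add_mem hw (W.smul_mem _ hu)
    | inv_mem t ht =>
      obtain ⟨u, hu, c, rfl⟩ := ht
      intro w hw
      rw [transvection_inv, transvection_smul]
      exact W.add_mem hw (W.smul_mem _ hu)
    | mul a b _ _ iha ihb => exact fun w hw ↦ by rw [mul_smul]; exact iha _ (ihb _ hw)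
  have hform : form g F x' (s • y) = form g F x y := by rw [← hsx, form_smul_smul]
  obtain ⟨t, ht, htx, hty⟩ := exists_smul_eq_and_smul_eq_self hx' (hsW s hs y hy) hy'
    (hform.trans h) (hform ▸ h0)
  exact ⟨t * s, Subgroup.mul_mem _ ht hs, by rw [mul_smul, hsx, htx], by rw [mul_smul, hty]⟩

/-- The vectors whose coordinates with indices in `S` vanish in both blocks. -/
def coordinateSubspace (F : Type*) [Field F] (S : Finset (Fin g)) :
    Submodule F (Fin g ⊕ Fin g → F) where
  carrier := {v | ∀ i ∈ S, v (Sum.inl i) = 0 ∧ v (Sum.inr i) = 0}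
  add_mem' hv hw i hi := by simp [hv i hi, hw i hi]
  zero_mem' := by simp
  smul_mem' c v hv i hi := by simp [hv i hi]

lemma single_inl_mem_coordinateSubspace {S : Finset (Fin g)} {j : Fin g} (hj : j ∉ S) :
    Pi.single (Sum.inl j) 1 ∈ coordinateSubspace F S := fun i hi ↦ by
  have : i ≠ j := fun h ↦ hj (h ▸ hi)
  simp [this]

lemma single_inr_mem_coordinateSubspace {S : Finset (Fin g)} {j : Fin g} (hj : j ∉ S) :
    Pi.single (Sum.inr j) 1 ∈ coordinateSubspace F S := fun i hi ↦ by
  have : i ≠ j := fun h ↦ hj (h ▸ hi)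
  simp [this]

lemma nondegenerateOn_coordinateSubspace (S : Finset (Fin g)) :
    NondegenerateOn (coordinateSubspace F S) := by
  intro u hu hu0
  obtain ⟨i | i, hi⟩ := Function.ne_iff.1 hu0
  · refine ⟨_, single_inr_mem_coordinateSubspace fun hiS ↦ hi (hu i hiS).1, ?_⟩
    rw [form_swap, form_single_inr]
    simpa using hi
  · refine ⟨_, single_inl_mem_coordinateSubspace fun hiS ↦ hi (hu i hiS).2, ?_⟩
    rw [form_swap, form_single_inl]
    simpa using hi

lemma nondegenerateOn_top : NondegenerateOn (⊤ : Submodule F (Fin g ⊕ Fin g → F)) := by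
  have h : coordinateSubspace F (∅ : Finset (Fin g)) = ⊤ := by
    ext
    simp [coordinateSubspace]
  exact h ▸ nondegenerateOn_coordinateSubspace ∅

lemma smul_mem_coordinateSubspace {S : Finset (Fin g)} {x : Sp g F}
    (hx : ∀ i ∈ S, x • (Pi.single (Sum.inl i) 1 : Fin g ⊕ Fin g → F) = Pi.single (Sum.inl i) 1 ∧
      x • (Pi.single (Sum.inr i) 1 : Fin g ⊕ Fin g → F) = Pi.single (Sum.inr i) 1)
    {v : Fin g ⊕ Fin g → F} (hv : v ∈ coordinateSubspace F S) :
    x • v ∈ coordinateSubspace F S := fun i hi ↦ by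
  constructor
  · rw [← neg_eq_zero, ← form_single_inr, ← (hx i hi).2, form_smul_smul, form_single_inr,
      (hv i hi).1, neg_zero]
  · rw [← form_single_inl i (x • v), ← (hx i hi).1, form_smul_smul, form_single_inl, (hv i hi).2]

lemma exists_mul_smul_single_eq (x : Sp g F) (S : Finset (Fin g)) :
    ∃ t ∈ transvectionSubgroup (⊤ : Submodule F (Fin g ⊕ Fin g → F)), ∀ i ∈ S,
      (t * x) • (Pi.single (Sum.inl i) 1 : Fin g ⊕ Fin g → F) = Pi.single (Sum.inl i) 1 ∧
      (t * x) • (Pi.single (Sum.inr i) 1 : Fin g ⊕ Fin g → F) = Pi.single (Sum.inr i) 1 := by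
  induction S using Finset.induction_on with
  | empty => exact ⟨1, Subgroup.one_mem _, by simp⟩
  | insert j S hj ih =>
    obtain ⟨t, ht, hfix⟩ := ih
    have hl := single_inl_mem_coordinateSubspace (F := F) hj
    have hr := single_inr_mem_coordinateSubspace (F := F) hj
    obtain ⟨s, hs, hsl, hsr⟩ := (nondegenerateOn_coordinateSubspace S).exists_smul_pair_eq
      (smul_mem_coordinateSubspace hfix hl) (smul_mem_coordinateSubspace hfix hr) hl hr
      (form_smul_smul _ _ _) (by rw [form_smul_smul, form_single_inl]; simp)
    refine ⟨s * t, Subgroup.mul_mem _ (transvectionSubgroup_mono le_top hs) ht, fun i hi ↦ ?_⟩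
    rw [mul_assoc, mul_smul, mul_smul s]
    obtain rfl | hi := Finset.mem_insert.1 hi
    · exact ⟨hsl, hsr⟩
    · rw [(hfix i hi).1, (hfix i hi).2]
      constructor
      · refine smul_eq_self_of_mem_transvectionSubgroup (fun u hu ↦ ?_) hs
        rw [form_swap, form_single_inl, (hu i hi).2, neg_zero]
      · refine smul_eq_self_of_mem_transvectionSubgroup (fun u hu ↦ ?_) hs
        rw [form_swap, form_single_inr, (hu i hi).1, neg_zero, neg_zero]

/-- The symplectic group is generated by transvections. -/
lemma transvectionSubgroup_top :
    transvectionSubgroup (⊤ : Submodule F (Fin g ⊕ Fin g → F)) = ⊤ := by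
  refine (Subgroup.eq_top_iff' _).2 fun x ↦ ?_
  obtain ⟨t, ht, hfix⟩ := exists_mul_smul_single_eq x Finset.univ
  have htx : t * x = 1 := by
    refine Subtype.ext (Units.ext (Matrix.ext_of_mulVec_single ?_))
    rintro (i | i)
    · exact (hfix i (Finset.mem_univ i)).1.trans (Matrix.one_mulVec _).symm
    · exact (hfix i (Finset.mem_univ i)).2.trans (Matrix.one_mulVec _).symm
  rw [eq_inv_of_mul_eq_one_right htx]
  exact Subgroup.inv_mem _ ht

lemma exists_smul_pair_eq {x y x' y' : Fin g ⊕ Fin g → F}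
    (h : form g F x y = form g F x' y') (h0 : form g F x y ≠ 0) :
    ∃ t : Sp g F, t • x = x' ∧ t • y = y' := by
  obtain ⟨t, -, ht⟩ := nondegenerateOn_top.exists_smul_pair_eq (Submodule.mem_top (x := x))
    (Submodule.mem_top (x := y)) Submodule.mem_top Submodule.mem_top h h0
  exact ⟨t, ht⟩

lemma exists_smul_eq {x y : Fin g ⊕ Fin g → F} (hx : x ≠ 0) (hy : y ≠ 0) :
    ∃ t : Sp g F, t • x = y := by
  obtain ⟨t, -, ht⟩ := nondegenerateOn_top.exists_smul_eq Submodule.mem_top Submodule.mem_top hx hy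
  exact ⟨t, ht⟩

/-- A symplectic matrix for which every vector is an eigenvector is `1` or `-1`. -/
lemma eq_one_or_eq_neg_one (hg : 1 ≤ g) (x : Sp g F)
    (h : ∀ v : Fin g ⊕ Fin g → F, ∃ a : F, x • v = a • v) :
    ((x : GL (Fin g ⊕ Fin g) F) : Matrix (Fin g ⊕ Fin g) (Fin g ⊕ Fin g) F) = 1 ∨
    ((x : GL (Fin g ⊕ Fin g) F) : Matrix (Fin g ⊕ Fin g) (Fin g ⊕ Fin g) F) = -1 := by
  set M := ((x : GL (Fin g ⊕ Fin g) F) : Matrix (Fin g ⊕ Fin g) (Fin g ⊕ Fin g) F) with hM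
  obtain ⟨a, ha⟩ := LinearMap.exists_eq_smul_id_of_forall_notLinearIndependent
    (f := Matrix.toLin' M) fun v hv ↦ by
      obtain ⟨a, ha⟩ := h v
      have := LinearIndependent.pair_iff.1 hv a (-1) (by
        rw [Matrix.toLin'_apply, hM, ← smul_eq, ha]; simp)
      simp at this
  have hxa (v : Fin g ⊕ Fin g → F) : x • v = a • v := by
    rw [smul_eq, ← hM, ← Matrix.toLin'_apply, ha]; simp
  have hmat (b : F) (hb : a = b) : M = b • (1 : Matrix (Fin g ⊕ Fin g) (Fin g ⊕ Fin g) F) := by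
    refine Matrix.ext_iff_mulVec.2 fun v ↦ ?_
    rw [← smul_eq, hxa, hb, Matrix.smul_mulVec, Matrix.one_mulVec]
  have hsq := form_smul_smul x (Pi.single (Sum.inl ⟨0, hg⟩) 1) (Pi.single (Sum.inr ⟨0, hg⟩) 1)
  simp only [hxa, map_smul, LinearMap.smul_apply, form_single_inl, Pi.single_eq_same,
    smul_eq_mul, mul_one] at hsq
  rcases mul_self_eq_one_iff.1 hsq with h1 | h1
  · left; simpa using hmat 1 h1
  · right; simpa using hmat (-1) h1

lemma exists_form_eq_zero_and_form_ne_zero {a b : Fin g ⊕ Fin g → F}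
    (h : ∀ c : F, a ≠ c • b) : ∃ v, form g F b v = 0 ∧ form g F a v ≠ 0 := by
  by_contra! hall
  have ha0 : a ≠ 0 := by simpa using h 0
  by_cases hb0 : b = 0
  · obtain ⟨v, -, hv⟩ := nondegenerateOn_top a Submodule.mem_top ha0
    exact hv (hall v (by simp [hb0]))
  obtain ⟨w, -, hw⟩ := nondegenerateOn_top b Submodule.mem_top hb0
  have hne : a - (form g F a w / form g F b w) • b ≠ 0 := sub_ne_zero.2 (h _)
  obtain ⟨v, -, hv⟩ := nondegenerateOn_top _ Submodule.mem_top hne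
  refine hv ?_
  have := hall (v - (form g F b v / form g F b w) • w) (by simp [hw])
  simp only [map_sub, map_smul, smul_eq_mul, LinearMap.sub_apply, LinearMap.smul_apply] at this ⊢
  rw [← this]
  ring

section Normal

variable {N : Subgroup (Sp g F)} [hN : N.Normal]

/-- A normal subgroup with a nonscalar element moves some vector to one not orthogonal to it. -/
lemma exists_mem_form_smul_ne_zero {n : Sp g F} (hn : n ∈ N) {x : Fin g ⊕ Fin g → F}
    (hx : ∀ a : F, n • x ≠ a • x) : ∃ m ∈ N, ∃ v, form g F v (m • v) ≠ 0 := by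
  obtain ⟨v, hv, hnv⟩ := exists_form_eq_zero_and_form_ne_zero hx
  refine ⟨n * (transvection x 1 * n⁻¹ * (transvection x 1)⁻¹),
    N.mul_mem hn (hN.conj_mem _ (N.inv_mem hn) _), v, ?_⟩
  rw [← mul_assoc, ← mul_assoc, conj_transvection, mul_smul, transvection_inv,
    transvection_smul x, hv]
  rw [mul_zero, zero_smul, add_zero, transvection_smul, map_add, form_self, map_smul,
    form_swap v]
  simpa using hnv

/-- A normal subgroup with an element moving a vector to one not orthogonal to it
is transitive on lines. -/
lemma exists_mem_smul_eq_smul {m : Sp g F} (hm : m ∈ N) {v : Fin g ⊕ Fin g → F}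
    (hv : form g F v (m • v) ≠ 0) {x y : Fin g ⊕ Fin g → F} (hx : x ≠ 0) (hy : y ≠ 0) :
    ∃ n ∈ N, ∃ a : F, n • x = a • y := by
  have key : ∀ x y : Fin g ⊕ Fin g → F, form g F x y ≠ 0 → ∃ n ∈ N, ∃ a : F, n • x = a • y := by
    intro x y hxy
    obtain ⟨t, htx, hty⟩ := exists_smul_pair_eq (x := v) (y := m • v) (x' := x)
      (y' := (form g F v (m • v) / form g F x y) • y) (by simp [hxy]) hv
    refine ⟨t * m * t⁻¹, hN.conj_mem m hm t, form g F v (m • v) / form g F x y, ?_⟩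
    rw [← hty, ← htx, mul_smul, inv_smul_smul, mul_smul]
  obtain ⟨z, -, hxz, hyz⟩ := nondegenerateOn_top.exists_form_ne_zero
    (Submodule.mem_top (x := x)) (Submodule.mem_top (x := y)) hx hy
  obtain ⟨n, hn, a, ha⟩ := key x z hxz
  obtain ⟨n', hn', b, hb⟩ := key z y (by rwa [form_swap, neg_ne_zero])
  refine ⟨n' * n, N.mul_mem hn' hn, a * b, ?_⟩
  rw [mul_smul, ha, smul_comm n' a z, hb, smul_smul]

end Normal

/-- If a quotient identifies transvections along different lines, it is commutative. -/
lemma commute_of_forall_exists_transvection {H : Type*} [Group H] {φ : Sp g F →* H}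
    (e : Fin g ⊕ Fin g → F)
    (h : ∀ (u : Fin g ⊕ Fin g → F) (c : F), ∃ d, φ (transvection u c) = φ (transvection e d))
    (x y : Sp g F) : φ x * φ y = φ y * φ x := by
  have hmem (z : Sp g F) : z ∈ Subgroup.closure {t | ∃ u ∈ (⊤ : Submodule F (Fin g ⊕ Fin g → F)),
      ∃ c, t = transvection u c} := by
    change z ∈ transvectionSubgroup ⊤
    rw [transvectionSubgroup_top]
    exact Subgroup.mem_top z
  induction hmem x, hmem y using Subgroup.closure_induction₂ with
  | mem s t hs ht =>
    obtain ⟨u, -, c, rfl⟩ := hs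
    obtain ⟨v, -, d, rfl⟩ := ht
    obtain ⟨c', hc'⟩ := h u c
    obtain ⟨d', hd'⟩ := h v d
    rw [hc', hd', ← map_mul, ← map_mul, transvection_mul, transvection_mul, add_comm]
  | one_left => simp
  | one_right => simp
  | mul_left x y z _ _ _ hxz hyz =>
    rw [map_mul]
    exact Commute.mul_left hxz hyz
  | mul_right x y z _ _ _ hzx hzy =>
    rw [map_mul]
    exact Commute.mul_right hzx hzy
  | inv_left x y _ _ hxy =>
    rw [map_inv]
    exact Commute.inv_left hxy
  | inv_right x y _ _ hxy =>
    rw [map_inv]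
    exact Commute.inv_right hxy

section Commutative

variable {H : Type*} [CommGroup H] (φ : Sp g F →* H)

lemma map_transvection_eq {u v : Fin g ⊕ Fin g → F} (hu : u ≠ 0) (hv : v ≠ 0) (c : F) :
    φ (transvection u c) = φ (transvection v c) := by
  obtain ⟨t, rfl⟩ := exists_smul_eq hu hv
  rw [← conj_transvection, map_mul, map_mul, map_inv, mul_inv_cancel_comm]

lemma map_transvection_eq_one_of_sq_ne_one {a : F} (ha : a ≠ 0) (ha1 : a ^ 2 ≠ 1)
    {u : Fin g ⊕ Fin g → F} (hu : u ≠ 0) (c : F) : φ (transvection u c) = 1 := by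
  have ha1' : a ^ 2 - 1 ≠ 0 := sub_ne_zero.2 ha1
  have h := map_transvection_eq φ (smul_ne_zero ha hu) hu (c / (a ^ 2 - 1))
  rw [transvection_vec_smul] at h
  have hc : c = a ^ 2 * (c / (a ^ 2 - 1)) + -(c / (a ^ 2 - 1)) := by
    field_simp
    ring
  rw [hc, ← transvection_mul, ← transvection_inv, map_mul, map_inv, h, mul_inv_cancel]

lemma transvection_add_mul_transvection_sub {u v : Fin g ⊕ Fin g → F} (h : form g F u v = 0)
    (c : F) : transvection (u + v) c * transvection (u - v) c =
      transvection u (2 * c) * transvection v (2 * c) := by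
  have h' : form g F v u = 0 := by rw [form_swap, h, neg_zero]
  refine eq_of_smul_eq fun w ↦ ?_
  simp only [mul_smul, transvection_smul, map_add, map_sub, map_smul, form_self, h, h',
    LinearMap.add_apply, LinearMap.sub_apply, smul_eq_mul]
  module

lemma transvection_add_add_mul {u v w : Fin g ⊕ Fin g → F} (huv : form g F u v = 0)
    (huw : form g F u w = 0) (hvw : form g F v w = 0) (c : F) :
    transvection (u + v + w) c * (transvection u c * transvection v c * transvection w c) =
      transvection (u + v) c * transvection (u + w) c * transvection (v + w) c := by
  have hvu : form g F v u = 0 := by rw [form_swap, huv, neg_zero]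
  have hwu : form g F w u = 0 := by rw [form_swap, huw, neg_zero]
  have hwv : form g F w v = 0 := by rw [form_swap, hvw, neg_zero]
  refine eq_of_smul_eq fun x ↦ ?_
  simp only [mul_smul, transvection_smul, map_add, map_smul, form_self, huv, huw, hvw, hvu, hwu,
    hwv, LinearMap.add_apply, smul_eq_mul]
  module

lemma map_transvection_eq_one_of_two_ne_zero (hg : 2 ≤ g) (h2 : (2 : F) ≠ 0)
    {u : Fin g ⊕ Fin g → F} (hu : u ≠ 0) (c : F) : φ (transvection u c) = 1 := by
  set e : Fin g ⊕ Fin g → F := Pi.single (Sum.inl ⟨0, by omega⟩) 1 with he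
  set f : Fin g ⊕ Fin g → F := Pi.single (Sum.inl ⟨1, by omega⟩) 1 with hf
  have h := congrArg φ (transvection_add_mul_transvection_sub (u := e) (v := f)
    (by rw [he, form_single_inl]; simp [hf]) (c / 2))
  have hne (v : Fin g ⊕ Fin g → F) (i : Fin g ⊕ Fin g) (hv : v i ≠ 0) : v ≠ 0 :=
    fun h0 ↦ hv (by simp [h0])
  rw [map_mul, map_mul,
    map_transvection_eq φ (hne (e + f) (Sum.inl ⟨0, by omega⟩) (by simp [he, hf])) hu,
    map_transvection_eq φ (hne (e - f) (Sum.inl ⟨0, by omega⟩) (by simp [he, hf])) hu,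
    map_transvection_eq φ (hne e (Sum.inl ⟨0, by omega⟩) (by simp [he])) hu,
    map_transvection_eq φ (hne f (Sum.inl ⟨1, by omega⟩) (by simp [hf])) hu,
    ← map_mul, transvection_mul, ← two_mul, mul_div_cancel₀ _ h2] at h
  exact left_eq_mul.1 h

lemma map_transvection_eq_one_of_three_le (hg : 3 ≤ g)
    {u : Fin g ⊕ Fin g → F} (hu : u ≠ 0) (c : F) : φ (transvection u c) = 1 := by
  set p : Fin g ⊕ Fin g → F := Pi.single (Sum.inl ⟨0, by omega⟩) 1 with hp
  set q : Fin g ⊕ Fin g → F := Pi.single (Sum.inl ⟨1, by omega⟩) 1 with hq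
  set r : Fin g ⊕ Fin g → F := Pi.single (Sum.inl ⟨2, by omega⟩) 1 with hr
  have h := congrArg φ (transvection_add_add_mul (u := p) (v := q) (w := r)
    (by rw [hp, form_single_inl]; simp [hq]) (by rw [hp, form_single_inl]; simp [hr])
    (by rw [hq, form_single_inl]; simp [hr]) c)
  have hne (v : Fin g ⊕ Fin g → F) (i : Fin g ⊕ Fin g) (hv : v i ≠ 0) : v ≠ 0 :=
    fun h0 ↦ hv (by simp [h0])
  simp only [map_mul] at h
  rw [map_transvection_eq φ (hne (p + q + r) (Sum.inl ⟨0, by omega⟩) (by simp [hp, hq, hr])) hu,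
    map_transvection_eq φ (hne (p + q) (Sum.inl ⟨0, by omega⟩) (by simp [hp, hq])) hu,
    map_transvection_eq φ (hne (p + r) (Sum.inl ⟨0, by omega⟩) (by simp [hp, hr])) hu,
    map_transvection_eq φ (hne (q + r) (Sum.inl ⟨1, by omega⟩) (by simp [hq, hr])) hu,
    map_transvection_eq φ (hne p (Sum.inl ⟨0, by omega⟩) (by simp [hp])) hu,
    map_transvection_eq φ (hne q (Sum.inl ⟨1, by omega⟩) (by simp [hq])) hu,
    map_transvection_eq φ (hne r (Sum.inl ⟨2, by omega⟩) (by simp [hr])) hu] at h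
  exact mul_eq_right.1 h

end Commutative

/-- Outside the exceptional cases, the square of some nonzero scalar is not `1`, or `g ≥ 2` and
`2` is invertible, or `g ≥ 3`. -/
lemma exists_sq_ne_one_or (hg : 1 ≤ g) (h1 : ¬(g = 1 ∧ Finite F ∧ Nat.card F ≤ 4))
    (h2 : ¬(g = 2 ∧ Nat.card F = 2)) :
    (∃ a : F, a ≠ 0 ∧ a ^ 2 ≠ 1) ∨ (2 ≤ g ∧ (2 : F) ≠ 0) ∨ 3 ≤ g := by
  classical
  by_contra! hcon
  obtain ⟨hsq, htwo, hlt⟩ := hcon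
  have hthree : (Set.univ : Set F) = ({0, 1, -1} : Finset F) := by
    refine (Set.eq_univ_iff_forall.2 fun a ↦ ?_).symm
    by_cases ha : a = 0
    · simp [ha]
    · simpa [ha] using hsq a ha
  have hcard : Nat.card F = ({0, 1, -1} : Finset F).card := by
    rw [← Set.ncard_univ, hthree, Set.ncard_coe_finset]
  have hfin : Finite F := Set.finite_univ_iff.1 (hthree ▸ Finset.finite_toSet _)
  by_cases hg1 : g = 1
  · exact h1 ⟨hg1, hfin, by rw [hcard]; exact Finset.card_le_three.trans (by norm_num)⟩
  · refine h2 ⟨by omega, ?_⟩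
    have hneg : (-1 : F) = 1 := by linear_combination -(htwo (by omega))
    rw [hcard, hneg]
    simp

/-- A homomorphism from the symplectic group to a commutative group is trivial outside
the exceptional cases. -/
lemma map_eq_one {H : Type*} [CommGroup H] (φ : Sp g F →* H) (hg : 1 ≤ g)
    (h1 : ¬(g = 1 ∧ Finite F ∧ Nat.card F ≤ 4)) (h2 : ¬(g = 2 ∧ Nat.card F = 2)) (x : Sp g F) :
    φ x = 1 := by
  suffices transvectionSubgroup (⊤ : Submodule F (Fin g ⊕ Fin g → F)) ≤ φ.ker from
    this (by rw [transvectionSubgroup_top]; exact Subgroup.mem_top x)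
  refine (Subgroup.closure_le _).2 ?_
  rintro _ ⟨u, -, c, rfl⟩
  change φ (transvection u c) = 1
  by_cases hu : u = 0
  · rw [hu, transvection_zero_vec, map_one]
  rcases exists_sq_ne_one_or hg h1 h2 with ⟨a, ha, ha1⟩ | ⟨hg2, h⟩ | hg3
  · exact map_transvection_eq_one_of_sq_ne_one φ ha ha1 hu c
  · exact map_transvection_eq_one_of_two_ne_zero φ hg2 h hu c
  · exact map_transvection_eq_one_of_three_le φ hg3 hu c

/-- Outside the exceptional cases, a normal subgroup with a nonscalar element is everything. -/
lemma forall_eigenvector_or_eq_top (hg : 1 ≤ g) (h1 : ¬(g = 1 ∧ Finite F ∧ Nat.card F ≤ 4))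
    (h2 : ¬(g = 2 ∧ Nat.card F = 2)) (N : Subgroup (Sp g F)) (hN : N.Normal) :
    (∀ x ∈ N, ∀ v : Fin g ⊕ Fin g → F, ∃ a : F, x • v = a • v) ∨ N = ⊤ := by
  refine or_iff_not_imp_left.2 fun hscalar ↦ ?_
  push Not at hscalar
  obtain ⟨n, hn, x, hx⟩ := hscalar
  obtain ⟨m, hm, v, hv⟩ := exists_mem_form_smul_ne_zero hn hx
  have hv0 : v ≠ 0 := ne_zero_of_form_ne_zero hv
  have hline (u : Fin g ⊕ Fin g → F) (c : F) : ∃ d, QuotientGroup.mk' N (transvection u c) =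
      QuotientGroup.mk' N (transvection v d) := by
    by_cases hu : u = 0
    · exact ⟨0, by rw [hu, transvection_zero_vec, transvection_zero]⟩
    obtain ⟨k, hk, a, ha⟩ := exists_mem_smul_eq_smul hm hv hu hv0
    have hk1 : QuotientGroup.mk' N k = 1 := (QuotientGroup.eq_one_iff k).2 hk
    refine ⟨a ^ 2 * c, ?_⟩
    rw [← transvection_vec_smul, ← ha, ← conj_transvection, map_mul, map_mul, map_inv, hk1]
    simp
  let : CommGroup (Sp g F ⧸ N) :=
    { (inferInstance : Group (Sp g F ⧸ N)) with
      mul_comm := by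
        rintro ⟨y⟩ ⟨z⟩
        exact commute_of_forall_exists_transvection v hline y z }
  exact (Subgroup.eq_top_iff' N).2 fun y ↦
    (QuotientGroup.eq_one_iff y).1 (map_eq_one (QuotientGroup.mk' N) hg h1 h2 y)

end SymplecticGenerators

theorem statement4 (F : Type*) [Field F] (g : ℕ) (hg : 1 ≤ g)
    (h1 : ¬(g = 1 ∧ Finite F ∧ Nat.card F ≤ 4))
    (h2 : ¬(g = 2 ∧ Nat.card F = 2))
    (N : Subgroup ↥(Sp g F)) (hN : N.Normal) :
    (∀ x ∈ N,
      ((x : GL (Fin g ⊕ Fin g) F) : Matrix (Fin g ⊕ Fin g) (Fin g ⊕ Fin g) F) = 1 ∨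
      ((x : GL (Fin g ⊕ Fin g) F) : Matrix (Fin g ⊕ Fin g) (Fin g ⊕ Fin g) F) = -1) ∨
    N = ⊤ :=
  (SymplecticGenerators.forall_eigenvector_or_eq_top hg h1 h2 N hN).imp_left fun h x hx ↦
    SymplecticGenerators.eq_one_or_eq_neg_one hg x (h x hx)
end

section
/- Let ℓ ≥ 5 be a prime and g ≥ 1. The quotient PSp_{2g}(ZMod ℓ) of Sp_{2g}(ZMod ℓ) by its center {I_{2g}, −I_{2g}} is a simple group which is not abelian. -/
open Matrix

namespace Sp

variable {g : ℕ} {F : Type*} [Field F]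

/-- The symplectic form with Gram matrix `Jmat g F`. -/
noncomputable def form (g : ℕ) (F : Type*) [Field F] : LinearMap.BilinForm F (Fin g ⊕ Fin g → F) :=
  Matrix.toBilin' (Jmat g F)

theorem Jmat_transpose : (Jmat g F)ᵀ = -Jmat g F := by
  simp [Jmat, Matrix.fromBlocks_transpose, Matrix.fromBlocks_neg]

theorem Jmat_mul_self : Jmat g F * Jmat g F = -1 := by
  simp [Jmat, Matrix.fromBlocks_multiply, ← Matrix.fromBlocks_one, Matrix.fromBlocks_neg]

theorem form_swap (x y : Fin g ⊕ Fin g → F) : form g F y x = -form g F x y := by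
  simp only [form, Matrix.toBilin'_apply']
  rw [Matrix.dotProduct_mulVec, ← Matrix.mulVec_transpose, Jmat_transpose, Matrix.neg_mulVec,
    neg_dotProduct, dotProduct_comm]

theorem form_self (x : Fin g ⊕ Fin g → F) : form g F x x = 0 := by
  simp [form, Matrix.toBilin'_apply', Jmat, Matrix.fromBlocks_mulVec, dotProduct,
    Fintype.sum_sum_type, Matrix.neg_mulVec, mul_comm]

theorem exists_form_ne_zero {x : Fin g ⊕ Fin g → F} (hx : x ≠ 0) : ∃ y, form g F x y ≠ 0 := by
  by_contra! h
  apply hx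
  have h1 : x ᵥ* Jmat g F = 0 := by
    refine dotProduct_eq_zero _ fun y => ?_
    rw [← Matrix.dotProduct_mulVec, ← Matrix.toBilin'_apply']
    exact h y
  have h2 : x ᵥ* Jmat g F ᵥ* Jmat g F = 0 := by rw [h1, Matrix.zero_vecMul]
  rwa [Matrix.vecMul_vecMul, Jmat_mul_self, Matrix.vecMul_neg, Matrix.vecMul_one,
    neg_eq_zero] at h2

/-- The space is not the union of the two hyperplanes `p^⊥` and `q^⊥`. -/
theorem exists_form_ne_zero_and {p q : Fin g ⊕ Fin g → F} (hp : p ≠ 0) (hq : q ≠ 0) :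
    ∃ x, form g F p x ≠ 0 ∧ form g F q x ≠ 0 := by
  obtain ⟨x, hx⟩ := exists_form_ne_zero hp
  obtain ⟨y, hy⟩ := exists_form_ne_zero hq
  by_cases hqx : form g F q x = 0
  · by_cases hpy : form g F p y = 0
    · exact ⟨x + y, by simpa [hpy] using hx, by simpa [hqx] using hy⟩
    · exact ⟨y, hpy, hy⟩
  · exact ⟨x, hx, hqx⟩

/-- The natural representation of `Sp g F`. -/
noncomputable def rep : Sp g F →* Module.End F (Fin g ⊕ Fin g → F) :=
  ((Matrix.toLinAlgEquiv' (R := F) (n := Fin g ⊕ Fin g)).toMonoidHom.comp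
    (Units.coeHom _)).comp (Sp g F).subtype

theorem rep_apply (h : Sp g F) (x : Fin g ⊕ Fin g → F) :
    rep h x = ((h : GL (Fin g ⊕ Fin g) F) : Matrix _ _ F) *ᵥ x := rfl

theorem rep_injective : Function.Injective (rep (g := g) (F := F)) := by
  intro h k hk
  exact Subtype.ext (Units.ext (Matrix.toLinAlgEquiv'.injective hk))

theorem ext_rep {h k : Sp g F} (H : ∀ x, rep h x = rep k x) : h = k :=
  rep_injective (LinearMap.ext H)

theorem rep_inv_rep (h : Sp g F) (x : Fin g ⊕ Fin g → F) : rep h⁻¹ (rep h x) = x := by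
  rw [← Module.End.mul_apply, ← map_mul, inv_mul_cancel, map_one, Module.End.one_apply]

theorem rep_rep_inv (h : Sp g F) (x : Fin g ⊕ Fin g → F) : rep h (rep h⁻¹ x) = x := by
  rw [← Module.End.mul_apply, ← map_mul, mul_inv_cancel, map_one, Module.End.one_apply]

theorem form_mulVec (M : Matrix (Fin g ⊕ Fin g) (Fin g ⊕ Fin g) F) (x y : Fin g ⊕ Fin g → F) :
    form g F (M *ᵥ x) (M *ᵥ y) = Matrix.toBilin' (Mᵀ * Jmat g F * M) x y := by
  simp only [form, Matrix.toBilin'_apply', ← Matrix.mulVec_mulVec, Matrix.dotProduct_mulVec x Mᵀ,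
    Matrix.vecMul_transpose]

theorem form_rep (h : Sp g F) (x y : Fin g ⊕ Fin g → F) :
    form g F (rep h x) (rep h y) = form g F x y := by
  rw [rep_apply, rep_apply, form_mulVec, h.2, form]

theorem mem_of_form {M : GL (Fin g ⊕ Fin g) F}
    (H : ∀ x y, form g F ((M : Matrix _ _ F) *ᵥ x) ((M : Matrix _ _ F) *ᵥ y) = form g F x y) :
    M ∈ Sp g F := by
  refine Matrix.toBilin'.injective (LinearMap.ext fun x => LinearMap.ext fun y => ?_)
  rw [← form_mulVec, H, form]

/-- The matrix of the symplectic transvection `x ↦ x + a ⟨v, x⟩ v`. -/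
def transvectionMatrix (v : Fin g ⊕ Fin g → F) (a : F) :
    Matrix (Fin g ⊕ Fin g) (Fin g ⊕ Fin g) F :=
  1 + a • Matrix.vecMulVec v (v ᵥ* Jmat g F)

theorem transvectionMatrix_mulVec (v x : Fin g ⊕ Fin g → F) (a : F) :
    transvectionMatrix v a *ᵥ x = x + (a * form g F v x) • v := by
  rw [transvectionMatrix, Matrix.add_mulVec, Matrix.one_mulVec, Matrix.smul_mulVec,
    Matrix.vecMulVec_mulVec, form, Matrix.toBilin'_apply', Matrix.dotProduct_mulVec, mul_smul]
  simp

theorem transvectionMatrix_mul_neg (v : Fin g ⊕ Fin g → F) (a : F) :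
    transvectionMatrix v a * transvectionMatrix v (-a) = 1 := by
  refine Matrix.toLin'.injective (LinearMap.ext fun x => ?_)
  simp only [Matrix.toLin'_apply, ← Matrix.mulVec_mulVec, transvectionMatrix_mulVec, map_add,
    map_smul, form_self, Matrix.one_mulVec]
  module

/-- The symplectic transvection `x ↦ x + a ⟨v, x⟩ v`. -/
def transvection (v : Fin g ⊕ Fin g → F) (a : F) : Sp g F :=
  ⟨⟨transvectionMatrix v a, transvectionMatrix v (-a), transvectionMatrix_mul_neg v a, by
    simpa using transvectionMatrix_mul_neg v (-a)⟩, mem_of_form fun x y => by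
    simp only [transvectionMatrix_mulVec, map_add, map_smul, LinearMap.add_apply,
      LinearMap.smul_apply, form_self, smul_eq_mul, form_swap v x]
    ring⟩

theorem rep_transvection (v x : Fin g ⊕ Fin g → F) (a : F) :
    rep (transvection v a) x = x + (a * form g F v x) • v :=
  transvectionMatrix_mulVec v x a

theorem transvection_add (v : Fin g ⊕ Fin g → F) (a b : F) :
    transvection v (a + b) = transvection v a * transvection v b := by
  refine ext_rep fun x => ?_
  simp only [map_mul, Module.End.mul_apply, rep_transvection, map_add, map_smul, form_self]
  module

theorem transvection_zero (v : Fin g ⊕ Fin g → F) : transvection v 0 = 1 :=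
  ext_rep fun x => by simp [rep_transvection]

theorem transvection_neg (v : Fin g ⊕ Fin g → F) (a : F) :
    transvection v (-a) = (transvection v a)⁻¹ := by
  rw [eq_inv_iff_mul_eq_one, ← transvection_add, neg_add_cancel, transvection_zero]

theorem transvection_smul (c : F) (v : Fin g ⊕ Fin g → F) (a : F) :
    transvection (c • v) a = transvection v (c ^ 2 * a) := by
  refine ext_rep fun x => ?_
  simp only [rep_transvection, map_smul, LinearMap.smul_apply, smul_eq_mul]
  module

theorem conj_transvection (h : Sp g F) (v : Fin g ⊕ Fin g → F) (a : F) :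
    h * transvection v a * h⁻¹ = transvection (rep h v) a := by
  rw [mul_inv_eq_iff_eq_mul]
  refine ext_rep fun x => ?_
  simp only [map_mul, Module.End.mul_apply, rep_transvection, map_add, map_smul, form_rep]

/-- The transvection along `w - v` that maps `v` to `w`. -/
theorem rep_transvection_sub {v w : Fin g ⊕ Fin g → F} (h : form g F w v ≠ 0) :
    rep (transvection (w - v) (form g F w v)⁻¹) v = w := by
  rw [rep_transvection]
  simp [form_self, h]

/-- The subspace of vectors fixed by `h`. -/
noncomputable def fixed (h : Sp g F) : Submodule F (Fin g ⊕ Fin g → F) :=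
  LinearMap.eqLocus (rep h) LinearMap.id

theorem mem_fixed {h : Sp g F} {x : Fin g ⊕ Fin g → F} : x ∈ fixed h ↔ rep h x = x := Iff.rfl

theorem form_rep_sub_of_mem_fixed {h : Sp g F} {x : Fin g ⊕ Fin g → F} (hx : x ∈ fixed h)
    (v : Fin g ⊕ Fin g → F) : form g F (rep h v - v) x = 0 := by
  have := form_rep h v x
  rw [mem_fixed.1 hx] at this
  simp [this]

theorem rep_transvection_of_mem_fixed {h : Sp g F} {x : Fin g ⊕ Fin g → F} (hx : x ∈ fixed h)
    (v : Fin g ⊕ Fin g → F) (a : F) : rep (transvection (rep h v - v) a) x = x := by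
  rw [rep_transvection, form_rep_sub_of_mem_fixed hx]
  simp

/-- A symplectic map moving some `v` to a vector not orthogonal to `v` can be corrected by a
transvection so that its fixed space grows. -/
theorem exists_fixed_lt {h : Sp g F} {v : Fin g ⊕ Fin g → F} (hv : form g F (rep h v) v ≠ 0) :
    ∃ u a, fixed h < fixed ((transvection u a)⁻¹ * h) := by
  refine ⟨rep h v - v, (form g F (rep h v) v)⁻¹, ?_⟩
  refine SetLike.lt_iff_le_and_exists.2 ⟨fun x hx => ?_, v, ?_, fun hx => ?_⟩
  · rw [mem_fixed, map_mul, Module.End.mul_apply, mem_fixed.1 hx, ← transvection_neg,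
      rep_transvection_of_mem_fixed hx]
  · rw [mem_fixed, map_mul, Module.End.mul_apply]
    have := rep_inv_rep (transvection (rep h v - v) (form g F (rep h v) v)⁻¹) v
    rwa [rep_transvection_sub hv] at this
  · rw [mem_fixed.1 hx] at hv
    exact hv (form_self v)

/-- The symplectic group is generated by transvections. -/
theorem eq_top_of_transvection_mem {N : Subgroup (Sp g F)} (hN : ∀ v a, transvection v a ∈ N) :
    N = ⊤ := by
  suffices H : ∀ (W : Submodule F (Fin g ⊕ Fin g → F)) (h : Sp g F), fixed h = W → h ∈ N from
    (Subgroup.eq_top_iff' N).2 fun h => H _ h rfl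
  intro W
  induction W using WellFoundedGT.induction with
  | ind W ih =>
    rintro h rfl
    by_cases h1 : h = 1
    · exact h1 ▸ N.one_mem
    obtain ⟨z, hz⟩ : ∃ z, rep h z - z ≠ 0 := by
      by_contra! H
      exact h1 (ext_rep fun x => by simpa [sub_eq_zero] using H x)
    by_cases hv : ∃ v, form g F (rep h v) v ≠ 0
    · obtain ⟨v, hv⟩ := hv
      obtain ⟨u, a, hlt⟩ := exists_fixed_lt hv
      exact (N.mul_mem_cancel_left (N.inv_mem (hN u a))).1 (ih _ hlt _ rfl)
    push Not at hv
    set t := transvection (rep h z - z) 1 with ht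
    have hz' : rep h⁻¹ (rep h z - z) ≠ 0 := fun H => hz (by
      rw [← rep_rep_inv h (rep h z - z), H, map_zero])
    obtain ⟨v, hv1, hv2⟩ := exists_form_ne_zero_and hz hz'
    have hv3 : form g F (rep h z - z) (rep h v) ≠ 0 := by
      rwa [← form_rep h⁻¹, rep_inv_rep]
    have hle : fixed h ≤ fixed (t * h) := fun x hx => by
      rw [mem_fixed, map_mul, Module.End.mul_apply, mem_fixed.1 hx,
        rep_transvection_of_mem_fixed hx]
    have hne : form g F (rep (t * h) v) v ≠ 0 := by
      rw [map_mul, Module.End.mul_apply, rep_transvection, map_add, map_smul,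
        LinearMap.add_apply, LinearMap.smul_apply, hv v, zero_add, one_mul]
      exact mul_ne_zero hv3 hv1
    obtain ⟨u, a, hlt⟩ := exists_fixed_lt hne
    have := ih _ (hle.trans_lt hlt) _ rfl
    exact (N.mul_mem_cancel_left (hN _ _)).1
      ((N.mul_mem_cancel_left (N.inv_mem (hN u a))).1 this)

/-- Transvections along all nonzero vectors are conjugate to those along a given one. -/
theorem transvection_mem_of_forall {N : Subgroup (Sp g F)} [N.Normal] {u : Fin g ⊕ Fin g → F}
    (hu : u ≠ 0) (hN : ∀ a, transvection u a ∈ N) (v : Fin g ⊕ Fin g → F) (a : F) :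
    transvection v a ∈ N := by
  have step : ∀ {x y : Fin g ⊕ Fin g → F}, form g F y x ≠ 0 →
      (∀ a, transvection x a ∈ N) → ∀ a, transvection y a ∈ N := by
    intro x y hxy hx b
    rw [← rep_transvection_sub hxy, ← conj_transvection]
    exact ‹N.Normal›.conj_mem _ (hx b) _
  by_cases hv : v = 0
  · rw [hv, show transvection (0 : Fin g ⊕ Fin g → F) a = 1 from
      ext_rep fun x => by simp [rep_transvection]]
    exact N.one_mem
  obtain ⟨x, hux, hvx⟩ := exists_form_ne_zero_and hu hv
  refine step hvx (step ?_ hN) a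
  rwa [form_swap, neg_ne_zero]

/-- In a hyperbolic plane spanned by `u` and `w`, a product of transvections doubles `u`. -/
theorem exists_rep_eq_two_smul (h2 : (2 : F) ≠ 0) {u w : Fin g ⊕ Fin g → F}
    (h : form g F u w ≠ 0) :
    ∃ p q r : F, rep (transvection w r * transvection u q * transvection w p) u = (2 : F) • u := by
  refine ⟨(form g F u w)⁻¹, -(form g F u w)⁻¹, -(2 * form g F u w)⁻¹, ?_⟩
  simp only [map_mul, Module.End.mul_apply, rep_transvection, map_add, map_smul, form_self,
    form_swap u w]
  match_scalars <;> field_simp <;> ring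

theorem transvection_mem_of_commute (h2 : (2 : F) ≠ 0) (h3 : (3 : F) ≠ 0)
    {N : Subgroup (Sp g F)} [N.Normal] {u w : Fin g ⊕ Fin g → F} (h : form g F u w ≠ 0)
    (hc : ∀ a b, Commute (QuotientGroup.mk' N (transvection w a))
      (QuotientGroup.mk' N (transvection u b))) (a : F) :
    transvection u a ∈ N := by
  obtain ⟨p, q, r, hD⟩ := exists_rep_eq_two_smul h2 h
  set D := transvection w r * transvection u q * transvection w p with hDdef
  have huu : ∀ a b, Commute (QuotientGroup.mk' N (transvection u a))
      (QuotientGroup.mk' N (transvection u b)) := fun a b => by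
    rw [Commute, SemiconjBy, ← map_mul, ← map_mul, ← transvection_add, ← transvection_add,
      add_comm]
  have hcD : Commute (QuotientGroup.mk' N D) (QuotientGroup.mk' N (transvection u (a / 3))) := by
    rw [hDdef, map_mul, map_mul]
    exact ((hc _ _).mul_left (huu _ _)).mul_left (hc _ _)
  have hconj : QuotientGroup.mk' N (D * transvection u (a / 3) * D⁻¹) =
      QuotientGroup.mk' N (transvection u (a / 3)) := by
    rw [map_mul, map_mul, map_inv, hcD.eq, mul_inv_cancel_right]
  rw [conj_transvection, hD, transvection_smul,
    show (2 : F) ^ 2 * (a / 3) = a + a / 3 by field_simp; ring, transvection_add, map_mul,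
    mul_eq_right] at hconj
  exact (QuotientGroup.eq_one_iff _).1 hconj

/-- A normal subgroup containing a map `k` with `u` and `k u` not orthogonal is everything. -/
theorem eq_top_of_form_ne_zero (h2 : (2 : F) ≠ 0) (h3 : (3 : F) ≠ 0)
    {N : Subgroup (Sp g F)} [N.Normal] {k : Sp g F} (hk : k ∈ N) {u : Fin g ⊕ Fin g → F}
    (hu : form g F u (rep k u) ≠ 0) : N = ⊤ := by
  have hu0 : u ≠ 0 := by
    rintro rfl
    simp at hu
  refine eq_top_of_transvection_mem (transvection_mem_of_forall hu0
    (transvection_mem_of_commute h2 h3 hu fun a b => ?_))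
  have hk1 : QuotientGroup.mk' N k = 1 := (QuotientGroup.eq_one_iff k).2 hk
  rw [← conj_transvection, map_mul, map_mul, map_inv, hk1, one_mul, inv_one, mul_one, Commute,
    SemiconjBy, ← map_mul, ← map_mul, ← transvection_add, ← transvection_add, add_comm]

theorem le_center_or_eq_top (h2 : (2 : F) ≠ 0) (h3 : (3 : F) ≠ 0)
    (N : Subgroup (Sp g F)) [N.Normal] : N ≤ Subgroup.center (Sp g F) ∨ N = ⊤ := by
  by_contra! H
  obtain ⟨hN, htop⟩ := H
  have horth : ∀ k ∈ N, ∀ u, form g F u (rep k u) = 0 := fun k hk u => by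
    by_contra hu
    exact htop (eq_top_of_form_ne_zero h2 h3 hk hu)
  refine hN fun h hh => ?_
  have key : Subgroup.centralizer {h} = ⊤ := by
    refine eq_top_of_transvection_mem fun v a => ?_
    rw [Subgroup.mem_centralizer_singleton_iff]
    suffices hv : transvection (rep h v) a = transvection v a by
      rw [← conj_transvection, mul_inv_eq_iff_eq_mul] at hv
      exact hv.symm
    by_cases hm : rep h v - v = 0
    · rw [sub_eq_zero.1 hm]
    by_cases hp : rep h v + v = 0
    · rw [eq_neg_of_add_eq_zero_left hp, ← neg_one_smul F v, transvection_smul]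
      norm_num
    obtain ⟨u, hu1, hu2⟩ := exists_form_ne_zero_and hm hp
    have hk : transvection (rep h v) 1 * transvection v (-1) ∈ N := by
      rw [← conj_transvection, transvection_neg, mul_assoc, mul_assoc]
      refine N.mul_mem hh ?_
      rw [← mul_assoc]
      exact ‹N.Normal›.conj_mem _ (N.inv_mem hh) _
    have hku := horth _ hk u
    have hvv : form g F (rep h v) v = 0 := by rw [form_swap, horth h hh, neg_zero]
    simp only [map_mul, Module.End.mul_apply, rep_transvection, map_add, map_smul, form_self, hvv,
      smul_eq_mul, form_swap (rep h v) u, form_swap v u] at hku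
    refine absurd (mul_ne_zero hu1 hu2) (not_not.2 ?_)
    simp only [map_sub, map_add, LinearMap.sub_apply, LinearMap.add_apply]
    linear_combination -hku
  rw [Subgroup.mem_center_iff]
  intro x
  have hx : x ∈ Subgroup.centralizer {h} := key ▸ Subgroup.mem_top x
  exact Subgroup.mem_centralizer_singleton_iff.1 hx

theorem not_commutative_quotient_center (h2 : (2 : F) ≠ 0) (h3 : (3 : F) ≠ 0) (hg : 1 ≤ g) :
    ¬ ∀ a b : Sp g F ⧸ Subgroup.center (Sp g F), a * b = b * a := by
  intro hc
  have : Nonempty (Fin g) := ⟨⟨0, hg⟩⟩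
  obtain ⟨u, hu⟩ := exists_ne (0 : Fin g ⊕ Fin g → F)
  obtain ⟨w, hw⟩ := exists_form_ne_zero hu
  have hmem := transvection_mem_of_commute h2 h3 hw (N := Subgroup.center (Sp g F))
    (fun a b => hc _ _) 1
  have hcomm := congrArg (fun h => form g F u (rep h w))
    (Subgroup.mem_center_iff.1 hmem (transvection w 1))
  simp only [map_mul, Module.End.mul_apply, rep_transvection, map_add, map_smul, form_self,
    smul_eq_mul, form_swap u w] at hcomm
  refine pow_ne_zero 3 hw ?_
  linear_combination -hcomm

theorem isSimpleGroup_quotient_center (h2 : (2 : F) ≠ 0) (h3 : (3 : F) ≠ 0) (hg : 1 ≤ g) :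
    IsSimpleGroup (Sp g F ⧸ Subgroup.center (Sp g F)) where
  exists_pair_ne := by
    by_contra! H
    exact not_commutative_quotient_center h2 h3 hg fun a b => H _ _
  eq_bot_or_eq_top_of_normal H hH := by
    have hsurj := QuotientGroup.mk'_surjective (Subgroup.center (Sp g F))
    rw [← Subgroup.map_comap_eq_self_of_surjective hsurj H]
    refine (le_center_or_eq_top h2 h3 (H.comap (QuotientGroup.mk' _))).imp (fun h => ?_)
      fun h => ?_
    · rwa [Subgroup.map_eq_bot_iff, QuotientGroup.ker_mk']
    · rw [h, Subgroup.map_top_of_surjective _ hsurj]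

end Sp

theorem statement6 (ℓ : ℕ) (hℓ : ℓ.Prime) (h5 : 5 ≤ ℓ) (g : ℕ) (hg : 1 ≤ g) :
    IsSimpleGroup (↥(Sp g (ZMod ℓ)) ⧸ Subgroup.center ↥(Sp g (ZMod ℓ))) ∧
    ¬ ∀ a b : ↥(Sp g (ZMod ℓ)) ⧸ Subgroup.center ↥(Sp g (ZMod ℓ)), a * b = b * a := by
  have : Fact ℓ.Prime := ⟨hℓ⟩
  have hne : ∀ n : ℕ, 0 < n → n < 5 → (n : ZMod ℓ) ≠ 0 := fun n hn hn5 h =>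
    absurd (Nat.le_of_dvd hn ((ZMod.natCast_eq_zero_iff n ℓ).1 h)) (by omega)
  have h2 : (2 : ZMod ℓ) ≠ 0 := mod_cast hne 2 (by norm_num) (by norm_num)
  have h3 : (3 : ZMod ℓ) ≠ 0 := mod_cast hne 3 (by norm_num) (by norm_num)
  exact ⟨Sp.isSimpleGroup_quotient_center h2 h3 hg, Sp.not_commutative_quotient_center h2 h3 hg⟩
end

section
/- Let ℓ ≥ 5 be a prime, let g₁, g₂ ≥ 1, let G be a group, and for i ∈ {1,2} let ρ_i : G → GL_{2g_i}(ZMod ℓ) be a group homomorphism whose image is the full symplectic similitude group GSp_{2g_i}(ZMod ℓ). Assume that the multipliers agree, i.e. λ(ρ₁(x)) = λ(ρ₂(x)) for every x ∈ G, and assume that ker ρ₂ is not contained in ker ρ₁. Then ρ₁(ker ρ₂) is a normal subgroup of GSp_{2g₁}(ZMod ℓ), it is contained in Sp_{2g₁}(ZMod ℓ), and it contains the element −I_{2g₁}. -/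
open Matrix

/-- The symplectic similitude group `GSp_{2g}(R)`: invertible matrices `M` such that
`Mᵀ J M = λ • J` for some unit `λ`, as a subgroup of `GL`. -/
def GSp (g : ℕ) (R : Type*) [CommRing R] :
    Subgroup (GL (Fin g ⊕ Fin g) R) where
  carrier := {M | ∃ l : Rˣ,
    (M : Matrix (Fin g ⊕ Fin g) (Fin g ⊕ Fin g) R)ᵀ * Jmat g R * M = (l : R) • Jmat g R}
  one_mem' := ⟨1, by simp⟩
  mul_mem' := by
    rintro a b ⟨la, ha⟩ ⟨lb, hb⟩
    refine ⟨la * lb, ?_⟩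
    show ((a * b : GL (Fin g ⊕ Fin g) R) : Matrix (Fin g ⊕ Fin g) (Fin g ⊕ Fin g) R)ᵀ *
        Jmat g R * (a * b : GL (Fin g ⊕ Fin g) R) = ((la * lb : Rˣ) : R) • Jmat g R
    rw [Units.val_mul, Matrix.transpose_mul]
    calc (b : Matrix (Fin g ⊕ Fin g) (Fin g ⊕ Fin g) R)ᵀ *
          (a : Matrix (Fin g ⊕ Fin g) (Fin g ⊕ Fin g) R)ᵀ * Jmat g R *
          ((a : Matrix (Fin g ⊕ Fin g) (Fin g ⊕ Fin g) R) * b)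
        = (b : Matrix (Fin g ⊕ Fin g) (Fin g ⊕ Fin g) R)ᵀ *
          ((a : Matrix (Fin g ⊕ Fin g) (Fin g ⊕ Fin g) R)ᵀ * Jmat g R *
            (a : Matrix (Fin g ⊕ Fin g) (Fin g ⊕ Fin g) R)) * b := by
          simp only [Matrix.mul_assoc]
      _ = (la : R) • ((b : Matrix (Fin g ⊕ Fin g) (Fin g ⊕ Fin g) R)ᵀ * Jmat g R * b) := by
          rw [ha, Matrix.mul_smul, Matrix.smul_mul]
      _ = ((la * lb : Rˣ) : R) • Jmat g R := by
          rw [hb, smul_smul, Units.val_mul]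
  inv_mem' := by
    rintro a ⟨la, ha⟩
    refine ⟨la⁻¹, ?_⟩
    show ((a⁻¹ : GL (Fin g ⊕ Fin g) R) : Matrix (Fin g ⊕ Fin g) (Fin g ⊕ Fin g) R)ᵀ *
        Jmat g R * (a⁻¹ : GL (Fin g ⊕ Fin g) R) = ((la⁻¹ : Rˣ) : R) • Jmat g R
    have h1 : (a : Matrix (Fin g ⊕ Fin g) (Fin g ⊕ Fin g) R) *
        ((a⁻¹ : GL (Fin g ⊕ Fin g) R) : Matrix (Fin g ⊕ Fin g) (Fin g ⊕ Fin g) R) = 1 :=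
      a.mul_inv
    have key : ((a⁻¹ : GL (Fin g ⊕ Fin g) R) : Matrix (Fin g ⊕ Fin g) (Fin g ⊕ Fin g) R)ᵀ *
        ((la : R) • Jmat g R) * (a⁻¹ : GL (Fin g ⊕ Fin g) R) = Jmat g R := by
      calc ((a⁻¹ : GL (Fin g ⊕ Fin g) R) : Matrix (Fin g ⊕ Fin g) (Fin g ⊕ Fin g) R)ᵀ *
            ((la : R) • Jmat g R) * (a⁻¹ : GL (Fin g ⊕ Fin g) R)
          = ((a⁻¹ : GL (Fin g ⊕ Fin g) R) : Matrix (Fin g ⊕ Fin g) (Fin g ⊕ Fin g) R)ᵀ *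
            ((a : Matrix (Fin g ⊕ Fin g) (Fin g ⊕ Fin g) R)ᵀ * Jmat g R * a) *
            ((a⁻¹ : GL (Fin g ⊕ Fin g) R) : Matrix (Fin g ⊕ Fin g) (Fin g ⊕ Fin g) R) := by
            rw [ha]
        _ = ((a : Matrix (Fin g ⊕ Fin g) (Fin g ⊕ Fin g) R) *
              ((a⁻¹ : GL (Fin g ⊕ Fin g) R) : Matrix (Fin g ⊕ Fin g) (Fin g ⊕ Fin g) R))ᵀ *
            Jmat g R *
            ((a : Matrix (Fin g ⊕ Fin g) (Fin g ⊕ Fin g) R) *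
              ((a⁻¹ : GL (Fin g ⊕ Fin g) R) : Matrix (Fin g ⊕ Fin g) (Fin g ⊕ Fin g) R)) := by
            rw [Matrix.transpose_mul]
            simp only [Matrix.mul_assoc]
        _ = Jmat g R := by rw [h1]; simp
    have expand : ((a⁻¹ : GL (Fin g ⊕ Fin g) R) : Matrix (Fin g ⊕ Fin g) (Fin g ⊕ Fin g) R)ᵀ *
        ((la : R) • Jmat g R) * (a⁻¹ : GL (Fin g ⊕ Fin g) R) =
        (la : R) • (((a⁻¹ : GL (Fin g ⊕ Fin g) R) : Matrix (Fin g ⊕ Fin g) (Fin g ⊕ Fin g) R)ᵀ *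
          Jmat g R * (a⁻¹ : GL (Fin g ⊕ Fin g) R)) := by
      rw [Matrix.mul_smul, Matrix.smul_mul]
    rw [expand] at key
    have := congrArg (fun X => ((la⁻¹ : Rˣ) : R) • X) key
    simpa [smul_smul] using this

section SymplecticTransvections

variable {g : ℕ} {F : Type*} [Field F]

/-- The symplectic form attached to `Jmat`. -/
def sympForm (x y : Fin g ⊕ Fin g → F) : F := x ⬝ᵥ (Jmat g F *ᵥ y)

theorem Jmat_transpose : (Jmat g F)ᵀ = -Jmat g F := by
  simp [Jmat, fromBlocks_transpose, fromBlocks_neg]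

theorem Jmat_mul_self : Jmat g F * Jmat g F = -1 := by
  simp [Jmat, fromBlocks_multiply, ← fromBlocks_one, fromBlocks_neg]

theorem sympForm_swap (x y : Fin g ⊕ Fin g → F) : sympForm x y = -sympForm y x := by
  unfold sympForm
  rw [dotProduct_mulVec, ← mulVec_transpose, Jmat_transpose, dotProduct_comm, neg_mulVec,
    dotProduct_neg]

theorem sympForm_self (x : Fin g ⊕ Fin g → F) : sympForm x x = 0 := by
  simp [sympForm, Jmat, dotProduct, fromBlocks_mulVec, neg_mulVec, mul_comm]

theorem sympForm_add_right (x y z : Fin g ⊕ Fin g → F) :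
    sympForm x (y + z) = sympForm x y + sympForm x z := by
  simp [sympForm, mulVec_add]

theorem sympForm_smul_right (c : F) (x y : Fin g ⊕ Fin g → F) :
    sympForm x (c • y) = c * sympForm x y := by
  simp [sympForm, mulVec_smul]

theorem sympForm_add_left (x y z : Fin g ⊕ Fin g → F) :
    sympForm (x + y) z = sympForm x z + sympForm y z := by
  simp [sympForm]

theorem sympForm_sub_left (x y z : Fin g ⊕ Fin g → F) :
    sympForm (x - y) z = sympForm x z - sympForm y z := by
  simp [sympForm]

theorem eq_zero_of_sympForm_eq_zero {x : Fin g ⊕ Fin g → F} (h : ∀ y, sympForm x y = 0) :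
    x = 0 := by
  refine dotProduct_eq_zero x fun y => ?_
  have := h (-(Jmat g F *ᵥ y))
  simpa [sympForm, mulVec_neg, mulVec_mulVec, Jmat_mul_self, neg_mulVec] using this

/-- The rank one nilpotent `x ↦ ω(v, x) v`. -/
def transvectionNil (v : Fin g ⊕ Fin g → F) : Matrix (Fin g ⊕ Fin g) (Fin g ⊕ Fin g) F :=
  vecMulVec v (v ᵥ* Jmat g F)

theorem transvectionNil_mulVec (v x : Fin g ⊕ Fin g → F) :
    transvectionNil v *ᵥ x = sympForm v x • v := by
  simp [transvectionNil, vecMulVec_mulVec, sympForm, dotProduct_mulVec]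

theorem transvectionNil_mul (u v : Fin g ⊕ Fin g → F) :
    transvectionNil u * transvectionNil v = sympForm u v • vecMulVec u (v ᵥ* Jmat g F) := by
  simp [transvectionNil, vecMulVec_mul_vecMulVec, sympForm, dotProduct_mulVec, vecMulVec_smul]

theorem transvectionNil_mul_self (v : Fin g ⊕ Fin g → F) :
    transvectionNil v * transvectionNil v = 0 := by
  simp [transvectionNil_mul, sympForm_self]

theorem transvectionNil_mul_mul (u v : Fin g ⊕ Fin g → F) :
    transvectionNil u * transvectionNil v * transvectionNil u =
      -(sympForm u v ^ 2) • transvectionNil u := by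
  rw [transvectionNil_mul, smul_mul, transvectionNil, vecMulVec_mul_vecMulVec,
    ← dotProduct_mulVec]
  change sympForm u v • vecMulVec u (sympForm v u • _) = _
  rw [vecMulVec_smul, smul_smul, sympForm_swap v u]
  ring_nf

theorem transvectionNil_transpose_mul_Jmat (v : Fin g ⊕ Fin g → F) :
    (transvectionNil v)ᵀ * Jmat g F = -(Jmat g F * transvectionNil v) := by
  rw [transvectionNil, transpose_vecMulVec, vecMulVec_mul, mul_vecMulVec, ← mulVec_transpose,
    Jmat_transpose, neg_mulVec, neg_vecMulVec]

/-- The symplectic transvection `x ↦ x + a ω(v, x) v`. -/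
def transvectionSp (v : Fin g ⊕ Fin g → F) (a : F) : Sp g F :=
  ⟨⟨1 + a • transvectionNil v, 1 - a • transvectionNil v,
    by simp [mul_sub, add_mul, transvectionNil_mul_self],
    by simp [sub_mul, mul_add, transvectionNil_mul_self]⟩, by
    change (1 + a • transvectionNil v)ᵀ * Jmat g F * (1 + a • transvectionNil v) = Jmat g F
    rw [transpose_add, transpose_one, transpose_smul, add_mul, smul_mul,
      transvectionNil_transpose_mul_Jmat]
    simp [add_mul, mul_add, Matrix.mul_assoc, transvectionNil_mul_self]⟩

/-- The matrix of an element of the symplectic group. -/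
def spMat (h : Sp g F) : Matrix (Fin g ⊕ Fin g) (Fin g ⊕ Fin g) F := h.1.1

theorem spMat_injective : Function.Injective (spMat (g := g) (F := F)) :=
  fun _ _ h => Subtype.ext (Units.ext h)

theorem spMat_mul (h k : Sp g F) : spMat (h * k) = spMat h * spMat k := rfl

theorem spMat_one : spMat (1 : Sp g F) = 1 := rfl

theorem spMat_transvectionSp (v : Fin g ⊕ Fin g → F) (a : F) :
    spMat (transvectionSp v a) = 1 + a • transvectionNil v := rfl

theorem transvectionSp_add (v : Fin g ⊕ Fin g → F) (a b : F) :
    transvectionSp v (a + b) = transvectionSp v a * transvectionSp v b := by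
  apply spMat_injective
  simp only [spMat_mul, spMat_transvectionSp, mul_add, add_mul, add_smul, smul_mul, Matrix.mul_smul,
    transvectionNil_mul_self, one_mul, mul_one, smul_zero]
  abel

theorem transvectionSp_zero (v : Fin g ⊕ Fin g → F) : transvectionSp v 0 = 1 := by
  apply spMat_injective
  simp [spMat_one, spMat_transvectionSp]

theorem transvectionSp_conj (h : Sp g F) (v : Fin g ⊕ Fin g → F) (a : F) :
    h * transvectionSp v a * h⁻¹ = transvectionSp (spMat h *ᵥ v) a := by
  rw [mul_inv_eq_iff_eq_mul]
  apply spMat_injective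
  have hJ : (spMat h)ᵀ * Jmat g F * spMat h = Jmat g F := h.2
  have key : spMat h * transvectionNil v = transvectionNil (spMat h *ᵥ v) * spMat h := by
    rw [transvectionNil, transvectionNil, mul_vecMulVec, vecMulVec_mul, ← vecMul_transpose,
      vecMul_vecMul, vecMul_vecMul, ← Matrix.mul_assoc, hJ]
  simp only [spMat_mul, spMat_transvectionSp, mul_add, add_mul, mul_one, one_mul, Matrix.mul_smul,
    smul_mul, key]

theorem transvectionSp_braid {u v : Fin g ⊕ Fin g → F} {a b : F}
    (h : a * b * sympForm u v ^ 2 = 1) :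
    transvectionSp v b * transvectionSp u a * transvectionSp v b =
      transvectionSp u a * transvectionSp v b * transvectionSp u a := by
  apply spMat_injective
  have braid : ∀ A B : Matrix (Fin g ⊕ Fin g) (Fin g ⊕ Fin g) F, A * A = 0 → B * B = 0 →
      A * B * A = -A → B * A * B = -B →
      (1 + B) * (1 + A) * (1 + B) = (1 + A) * (1 + B) * (1 + A) := by
    intro A B hA hB hABA hBAB
    simp only [mul_add, add_mul, mul_one, one_mul, hA, hB, hABA, hBAB]
    abel
  refine braid _ _ ?_ ?_ ?_ ?_
  · simp [transvectionNil_mul_self]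
  · simp [transvectionNil_mul_self]
  · simp only [Matrix.mul_smul, smul_mul, transvectionNil_mul_mul, smul_smul]
    rw [← neg_smul]
    congr 1
    linear_combination (-a) * h
  · simp only [Matrix.mul_smul, smul_mul, transvectionNil_mul_mul, smul_smul]
    rw [← neg_smul, sympForm_swap v u]
    congr 1
    linear_combination (-b) * h

theorem exists_sympForm_ne_zero_and {x y : Fin g ⊕ Fin g → F} (hx : x ≠ 0) (hy : y ≠ 0) :
    ∃ z, sympForm x z ≠ 0 ∧ sympForm y z ≠ 0 := by
  obtain ⟨p, hp⟩ := not_forall.1 (mt eq_zero_of_sympForm_eq_zero hx)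
  obtain ⟨q, hq⟩ := not_forall.1 (mt eq_zero_of_sympForm_eq_zero hy)
  by_contra! H
  have h1 := H p hp
  have h2 : sympForm x q = 0 := by_contra fun h => hq (H q h)
  refine hq ?_
  have h3 := H (p + q) (by rwa [sympForm_add_right, h2, add_zero])
  rwa [sympForm_add_right, h1, zero_add] at h3

theorem transvectionSp_mem_of_forall {N : Subgroup (Sp g F)} [N.Normal]
    {v : Fin g ⊕ Fin g → F} (hv0 : v ≠ 0) (hv : ∀ a, transvectionSp v a ∈ N)
    (w : Fin g ⊕ Fin g → F) (a : F) : transvectionSp w a ∈ N := by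
  have move : ∀ x y : Fin g ⊕ Fin g → F, sympForm x y ≠ 0 →
      (∀ a, transvectionSp x a ∈ N) → ∀ a, transvectionSp y a ∈ N := by
    intro x y hxy hx a
    have := Subgroup.Normal.conj_mem ‹N.Normal› _ (hx a)
      (transvectionSp (y - x) (sympForm y x)⁻¹)
    rw [transvectionSp_conj] at this
    convert this
    have hyx : sympForm y x ≠ 0 := by rwa [sympForm_swap, neg_ne_zero]
    rw [spMat_transvectionSp, add_mulVec, smul_mulVec, transvectionNil_mulVec,
      sympForm_sub_left, sympForm_self, sub_zero, smul_smul, inv_mul_cancel₀ hyx]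
    simp
  by_cases hw : w = 0
  · subst hw
    convert N.one_mem
    apply spMat_injective
    simp [spMat_one, spMat_transvectionSp, transvectionNil]
  · obtain ⟨z, h1, h2⟩ := exists_sympForm_ne_zero_and hv0 hw
    exact move z w (by rwa [sympForm_swap, neg_ne_zero]) (move v z h1 hv) a

theorem mem_of_transvectionNil_sum {N : Subgroup (Sp g F)}
    (hN : ∀ v a, transvectionSp v a ∈ N) (w : Fin g → Fin g ⊕ Fin g → F)
    (hw : ∀ i j, sympForm (w i) (w j) = 0) (s : Finset (Fin g)) :
    ∃ h ∈ N, spMat h = 1 + ∑ i ∈ s, transvectionNil (w i) := by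
  classical
  induction s using Finset.induction_on with
  | empty => exact ⟨1, N.one_mem, by simp [spMat_one]⟩
  | insert i s hi ih =>
    obtain ⟨h, hh, e⟩ := ih
    refine ⟨transvectionSp (w i) 1 * h, N.mul_mem (hN _ _) hh, ?_⟩
    have hz : transvectionNil (w i) * ∑ j ∈ s, transvectionNil (w j) = 0 := by
      simp [Finset.mul_sum, transvectionNil_mul, hw]
    rw [spMat_mul, e, spMat_transvectionSp, Finset.sum_insert hi, one_smul, mul_add, mul_one,
      add_mul, one_mul, hz, add_zero, add_assoc]

theorem sum_transvectionNil_inl :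
    ∑ i : Fin g, transvectionNil (Pi.single (Sum.inl i) (1 : F)) = fromBlocks 0 1 0 0 := by
  ext (i | i) (j | j) <;>
    simp [transvectionNil, Matrix.sum_apply, vecMulVec_apply, Jmat, Pi.single_apply,
      Matrix.one_apply]

theorem sum_transvectionNil_inr :
    ∑ i : Fin g, transvectionNil (Pi.single (Sum.inr i) (1 : F)) = fromBlocks 0 0 (-1) 0 := by
  ext (i | i) (j | j) <;>
    simp [transvectionNil, Matrix.sum_apply, vecMulVec_apply, Jmat, Pi.single_apply,
      Matrix.one_apply]

theorem exists_mem_spMat_eq_neg_one {N : Subgroup (Sp g F)}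
    (hN : ∀ v a, transvectionSp v a ∈ N) : ∃ h ∈ N, spMat h = -1 := by
  obtain ⟨x, hx, ex⟩ := mem_of_transvectionNil_sum hN
    (fun i => Pi.single (Sum.inl i) (1 : F)) (by simp [sympForm, Jmat]) Finset.univ
  obtain ⟨y, hy, ey⟩ := mem_of_transvectionNil_sum hN
    (fun i => Pi.single (Sum.inr i) (1 : F)) (by simp [sympForm, Jmat]) Finset.univ
  have hm := N.mul_mem (N.mul_mem hx hy) hx
  refine ⟨x * y * x * (x * y * x), N.mul_mem hm hm, ?_⟩
  have hJ : spMat (x * y * x) = Jmat g F := by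
    rw [spMat_mul, spMat_mul, ex, ey, sum_transvectionNil_inl, sum_transvectionNil_inr,
      ← fromBlocks_one, fromBlocks_add, fromBlocks_add]
    simp [fromBlocks_multiply, Jmat]
  rw [spMat_mul, hJ, Jmat_mul_self]

theorem transvectionSp_mem_of_sympForm_ne_zero {ℓ : ℕ} [Fact ℓ.Prime] (h5 : 5 ≤ ℓ)
    {N : Subgroup (Sp g (ZMod ℓ))} [hN : N.Normal] {h : Sp g (ZMod ℓ)} (hh : h ∈ N)
    {v : Fin g ⊕ Fin g → ZMod ℓ} (hv : sympForm v (spMat h *ᵥ v) ≠ 0)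
    (w : Fin g ⊕ Fin g → ZMod ℓ) (a : ZMod ℓ) : transvectionSp w a ∈ N := by
  have small : ∀ k : ℕ, 0 < k → k < 5 → (k : ZMod ℓ) ≠ 0 := by
    intro k hk hk5 h0
    rw [ZMod.natCast_eq_zero_iff] at h0
    exact absurd (Nat.le_of_dvd hk h0) (by omega)
  have two : (2 : ZMod ℓ) ≠ 0 := by exact_mod_cast small 2 (by norm_num) (by norm_num)
  have three : (3 : ZMod ℓ) ≠ 0 := by exact_mod_cast small 3 (by norm_num) (by norm_num)
  set u := spMat h *ᵥ v with hu
  set c := sympForm u v with hc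
  have hc0 : c ≠ 0 := by rwa [hc, sympForm_swap, neg_ne_zero]
  have congr_mod : ∀ a, (transvectionSp u a : Sp g (ZMod ℓ) ⧸ N) = transvectionSp v a := by
    intro a
    rw [hu, ← transvectionSp_conj, QuotientGroup.mk_mul, QuotientGroup.mk_mul,
      QuotientGroup.mk_inv, (QuotientGroup.eq_one_iff h).2 hh]
    simp
  have braid := transvectionSp_braid (u := u) (v := v) (a := 1 / (2 * c)) (b := 2 / c)
    (by rw [← hc]; field_simp)
  have braid_mod := congrArg (QuotientGroup.mk (s := N)) braid
  simp only [QuotientGroup.mk_mul, congr_mod] at braid_mod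
  simp only [← QuotientGroup.mk_mul, ← transvectionSp_add] at braid_mod
  rw [QuotientGroup.eq] at braid_mod
  have gen : transvectionSp v (3 / (2 * c)) ∈ N := by
    have e : 1 / (2 * c) + 2 / c + 1 / (2 * c) =
        2 / c + 1 / (2 * c) + 2 / c + -(3 / (2 * c)) := by field_simp; ring
    rw [e, transvectionSp_add v (_ + _ + _), transvectionSp_add v (_ + _),
      inv_mul_cancel_left] at braid_mod
    have := N.inv_mem braid_mod
    convert this
    rw [eq_inv_iff_mul_eq_one, ← transvectionSp_add, add_neg_cancel, transvectionSp_zero]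
  have mult : ∀ k : ℕ, transvectionSp v (k * (3 / (2 * c))) ∈ N := by
    intro k
    induction k with
    | zero => simp [transvectionSp_zero, N.one_mem]
    | succ k ih =>
      rw [Nat.cast_succ, add_mul, one_mul, transvectionSp_add]
      exact N.mul_mem ih gen
  refine transvectionSp_mem_of_forall (v := v) ?_ (fun t => ?_) w a
  · rintro rfl
    exact hv (by simp [sympForm])
  · have := mult (t / (3 / (2 * c))).val
    rw [ZMod.natCast_zmod_val] at this
    rwa [div_mul_cancel₀ _ (div_ne_zero three (mul_ne_zero two hc0))] at this

theorem exists_mem_spMat_eq_neg_one_of_ne_one {ℓ : ℕ} [Fact ℓ.Prime] (h5 : 5 ≤ ℓ)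
    {N : Subgroup (Sp g (ZMod ℓ))} [hN : N.Normal] {h : Sp g (ZMod ℓ)} (hh : h ∈ N)
    (h1 : h ≠ 1) : ∃ k ∈ N, spMat k = -1 := by
  by_cases A : ∃ k ∈ N, ∃ v, sympForm v (spMat k *ᵥ v) ≠ 0
  · obtain ⟨k, hk, v, hv⟩ := A
    exact exists_mem_spMat_eq_neg_one (transvectionSp_mem_of_sympForm_ne_zero h5 hk hv)
  push Not at A
  have sq : ∀ v w, sympForm (spMat h *ᵥ v - v) w = 0 ∨ sympForm (spMat h *ᵥ v + v) w = 0 := by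
    intro v w
    have hm : transvectionSp (spMat h *ᵥ v) 1 * transvectionSp v (-1) ∈ N := by
      have e : transvectionSp v (-1) = (transvectionSp v 1)⁻¹ := by
        rw [eq_inv_iff_mul_eq_one, ← transvectionSp_add, neg_add_cancel, transvectionSp_zero]
      rw [e, ← transvectionSp_conj, mul_assoc, mul_assoc, ← mul_assoc (transvectionSp v 1)]
      exact N.mul_mem hh (hN.conj_mem _ (N.inv_mem hh) _)
    have hw := A _ hm w
    have hv : sympForm (spMat h *ᵥ v) v = 0 := by rw [sympForm_swap, A h hh v, neg_zero]
    rw [← mul_eq_zero, sympForm_sub_left, sympForm_add_left]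
    simp only [spMat_mul, spMat_transvectionSp, ← mulVec_mulVec, add_mulVec, one_mulVec,
      smul_mulVec, transvectionNil_mulVec, sympForm_add_right, sympForm_smul_right, hv,
      sympForm_self] at hw
    rw [sympForm_swap w v, sympForm_swap w (spMat h *ᵥ v)] at hw
    linear_combination -hw
  have pm : ∀ v, spMat h *ᵥ v - v = 0 ∨ spMat h *ᵥ v + v = 0 := by
    intro v
    by_contra! H
    obtain ⟨z, hz1, hz2⟩ := exists_sympForm_ne_zero_and H.1 H.2
    exact (sq v z).elim hz1 hz2
  refine ⟨h, hh, ?_⟩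
  obtain ⟨p, hp⟩ : ∃ p, spMat h *ᵥ p - p ≠ 0 := by
    by_contra! H
    refine h1 (spMat_injective (ext_of_mulVec_single fun i => ?_))
    rw [sub_eq_zero.1 (H _), spMat_one, one_mulVec]
  have neg : ∀ v, spMat h *ᵥ v + v = 0 := by
    intro v
    by_contra hv
    have hv' := (pm v).resolve_right hv
    have hp' := (pm p).resolve_left hp
    rcases pm (p + v) with H | H
    · refine hp ?_
      rw [mulVec_add] at H
      linear_combination H - hv'
    · refine hv ?_
      rw [mulVec_add] at H
      linear_combination H - hp'
  refine ext_of_mulVec_single fun i => ?_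
  rw [eq_neg_of_add_eq_zero_left (neg _), neg_mulVec, one_mulVec]

end SymplecticTransvections

theorem statement9 (ℓ : ℕ) (hℓ : ℓ.Prime) (h5 : 5 ≤ ℓ)
    (g₁ g₂ : ℕ) (hg₁ : 1 ≤ g₁) (hg₂ : 1 ≤ g₂) (G : Type*) [Group G]
    (ρ₁ : G →* GL (Fin g₁ ⊕ Fin g₁) (ZMod ℓ)) (ρ₂ : G →* GL (Fin g₂ ⊕ Fin g₂) (ZMod ℓ))
    (h₁ : ρ₁.range = GSp g₁ (ZMod ℓ)) (h₂ : ρ₂.range = GSp g₂ (ZMod ℓ))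
    (hmult : ∀ x : G, ∃ l : (ZMod ℓ)ˣ,
      ((ρ₁ x : Matrix (Fin g₁ ⊕ Fin g₁) (Fin g₁ ⊕ Fin g₁) (ZMod ℓ))ᵀ * Jmat g₁ (ZMod ℓ) *
          (ρ₁ x) = (l : ZMod ℓ) • Jmat g₁ (ZMod ℓ)) ∧
      ((ρ₂ x : Matrix (Fin g₂ ⊕ Fin g₂) (Fin g₂ ⊕ Fin g₂) (ZMod ℓ))ᵀ * Jmat g₂ (ZMod ℓ) *
          (ρ₂ x) = (l : ZMod ℓ) • Jmat g₂ (ZMod ℓ)))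
    (hker : ¬ ρ₂.ker ≤ ρ₁.ker) :
    ((ρ₂.ker.map ρ₁).subgroupOf (GSp g₁ (ZMod ℓ))).Normal ∧
    ρ₂.ker.map ρ₁ ≤ Sp g₁ (ZMod ℓ) ∧
    (-1 : GL (Fin g₁ ⊕ Fin g₁) (ZMod ℓ)) ∈ ρ₂.ker.map ρ₁ := by
  have := Fact.mk hℓ
  have hSp : ρ₂.ker.map ρ₁ ≤ Sp g₁ (ZMod ℓ) := by
    rintro _ ⟨x, hx, rfl⟩
    obtain ⟨l, e₁, e₂⟩ := hmult x
    rw [MonoidHom.mem_ker.1 hx] at e₂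
    have hl := congrFun (congrFun e₂ (Sum.inl ⟨0, hg₂⟩)) (Sum.inr ⟨0, hg₂⟩)
    simp [Jmat] at hl
    change _ = _
    rw [e₁, ← hl, one_smul]
  have conj : ∀ k ∈ GSp g₁ (ZMod ℓ), ∀ n ∈ ρ₂.ker.map ρ₁, k * n * k⁻¹ ∈ ρ₂.ker.map ρ₁ := by
    rintro k hk _ ⟨x, hx, rfl⟩
    rw [← h₁] at hk
    obtain ⟨y, rfl⟩ := hk
    exact ⟨y * x * y⁻¹, (MonoidHom.normal_ker ρ₂).conj_mem x hx y, by simp⟩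
  refine ⟨⟨fun n hn k => conj k k.2 n hn⟩, hSp, ?_⟩
  obtain ⟨x, hx, hx1⟩ := SetLike.not_le_iff_exists.1 hker
  have hN : ((ρ₂.ker.map ρ₁).subgroupOf (Sp g₁ (ZMod ℓ))).Normal :=
    ⟨fun n hn k => conj k ⟨1, by rw [Units.val_one, one_smul]; exact k.2⟩ n hn⟩
  have hxm : ρ₁ x ∈ ρ₂.ker.map ρ₁ := ⟨x, hx, rfl⟩
  obtain ⟨k, hk, e⟩ := exists_mem_spMat_eq_neg_one_of_ne_one h5
    (N := (ρ₂.ker.map ρ₁).subgroupOf (Sp g₁ (ZMod ℓ))) (h := ⟨ρ₁ x, hSp hxm⟩) hxm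
    fun h => hx1 (congrArg Subtype.val h)
  have hk1 : (k : GL (Fin g₁ ⊕ Fin g₁) (ZMod ℓ)) = -1 := Units.ext e
  rw [← hk1]
  exact hk
end
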